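/- arXiv:1011.3996 — 3 statements merged into one kernel-verified Lean document; each statement's English description precedes it below -/
import Mathlib

section
/- Theorem 3.1(ii), existence: Suppose ρ ∈ BV(H,H₁), ρ ≥ 0 and ρ ∈ L¹(H,μ). Then there exist a finite positive Borel measure m on H and a Borel map σ : H → H₁* such that ‖σ(z)‖_{H₁*} = 1 for m-a.e. z, m(H) = V(ρ), and ∫_H D*G(z) ρ(z) μ(dz) = ∫_H ⟨G(z), σ(z)⟩ m(dz) for every G ∈ (C_b¹)_{D(A)∩H₁}, where ⟨·,·⟩ denotes the duality pairing between H₁ and H₁*. -/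
open MeasureTheory Filter
open scoped RealInnerProductSpace ENNReal NNReal BigOperators

noncomputable section

variable {H : Type*} [NormedAddCommGroup H] [InnerProductSpace ℝ H]

/-- `v ∈ C_b¹(H)` with gradient `Dv`: `v` is bounded, everywhere Fréchet differentiable with
derivative represented by the gradient `Dv`, and `Dv` is continuous and bounded. -/
def IsCb1 (v : H → ℝ) (Dv : H → H) : Prop :=
  (∀ x : H, HasFDerivAt v (innerSL ℝ (Dv x)) x) ∧ Continuous Dv ∧
    (∃ C, ∀ x, |v x| ≤ C) ∧ ∃ C, ∀ x, ‖Dv x‖ ≤ C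

/-- The operator `A` determined by `A e_j = α_j e_j`. -/
def Aop (e : ℕ → H) (α : ℕ → ℝ) (x : H) : H := ∑' j, (α j * ⟪x, e j⟫) • e j

/-- Membership in the domain `D(A)`. -/
def memDA (e : ℕ → H) (α : ℕ → ℝ) (x : H) : Prop :=
  Summable fun j => α j ^ 2 * ⟪x, e j⟫ ^ 2

/-- The covariance operator `Q = (1/2) A⁻¹`, i.e. `Q e_j = (2 α_j)⁻¹ e_j`. -/
def Qop (e : ℕ → H) (α : ℕ → ℝ) (x : H) : H := ∑' j, ((2 * α j)⁻¹ * ⟪x, e j⟫) • e j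

/-- `Q^{1/2}`, i.e. `Q^{1/2} e_j = (2 α_j)^{-1/2} e_j`. -/
def Qhalf (e : ℕ → H) (α : ℕ → ℝ) (x : H) : H :=
  ∑' j, ((Real.sqrt (2 * α j))⁻¹ * ⟪x, e j⟫) • e j

/-- `D*G` for `G(z) = ∑_{i} g_i(z) l^i` (`Dg i` being the gradient of `g i`):
`D*G(z) = ∑ i (−⟨l^i, Dg_i(z)⟩ + 2 g_i(z) ⟨A l^i, z⟩)`. -/
def Dstar (e : ℕ → H) (α : ℕ → ℝ) {m : ℕ} (g : Fin m → H → ℝ) (Dg : Fin m → H → H)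
    (l : Fin m → H) (z : H) : ℝ :=
  ∑ i, (-⟪l i, Dg i z⟫ + 2 * g i z * ⟪Aop e α (l i), z⟫)

/-- Membership in `H₁ = {x : ∑_j c_j² ⟨x,e_j⟩² < ∞}`. -/
def memH1 (c : ℕ → ℝ) (e : ℕ → H) (x : H) : Prop :=
  Summable fun j => c j ^ 2 * ⟪x, e j⟫ ^ 2

/-- The squared `H₁`-norm `∑_j c_j² ⟨x,e_j⟩²`. -/
def normH1sq (c : ℕ → ℝ) (e : ℕ → H) (x : H) : ℝ := ∑' j, c j ^ 2 * ⟪x, e j⟫ ^ 2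

/-- The `H₁`-inner product `∑_j c_j² ⟨x,e_j⟩⟨y,e_j⟩`. -/
def innerH1 (c : ℕ → ℝ) (e : ℕ → H) (x y : H) : ℝ :=
  ∑' j, c j ^ 2 * (⟪x, e j⟫ * ⟪y, e j⟫)

/-- `A_{1/2}(x) = ∫₀ˣ (log(1+s))^{1/2} ds`. -/
def A12 (x : ℝ) : ℝ := ∫ s in (0:ℝ)..x, Real.sqrt (Real.log (1 + s))

/-- `ψ(y) = ∫₀ʸ (exp(t²) − 1) dt`. -/
def psiOrlicz (y : ℝ) : ℝ := ∫ t in (0:ℝ)..y, (Real.exp (t ^ 2) - 1)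

variable [MeasurableSpace H]

/-- The set whose infimum is the Luxemburg norm of `f` for the Young function `Φ`. -/
def LuxSet (Φ : ℝ → ℝ) (μ : Measure H) (f : H → ℝ) : Set ℝ :=
  {a | 0 < a ∧ ∫ x, Φ (|f x| / a) ∂μ ≤ 1}

/-- The Luxemburg norm. -/
def LuxNorm (Φ : ℝ → ℝ) (μ : Measure H) (f : H → ℝ) : ℝ := sInf (LuxSet Φ μ f)

/-- The set of numbers `∫_H D*G ρ dμ`, where `G` ranges over all
`G ∈ (C_b¹)_{D(A)∩H₁}` with `‖G(z)‖_{H₁} ≤ 1` for all `z`; its supremum is `V(ρ)`. -/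
def BVset (c : ℕ → ℝ) (e : ℕ → H) (α : ℕ → ℝ) (μ : Measure H) (ρ : H → ℝ) : Set ℝ :=
  {r | ∃ (m : ℕ) (g : Fin m → H → ℝ) (Dg : Fin m → H → H) (l : Fin m → H),
    (∀ i, IsCb1 (g i) (Dg i)) ∧ (∀ i, memDA e α (l i)) ∧ (∀ i, memH1 c e (l i)) ∧
    (∀ z, memH1 c e (∑ i, g i z • l i) ∧ normH1sq c e (∑ i, g i z • l i) ≤ 1) ∧
    r = ∫ z, Dstar e α g Dg l z * ρ z ∂μ}

/-- The analogous set for `H₁ = H` (weights `c_j ≡ 1`), where the constraint is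
`|G(z)| ≤ 1` in `H`; its supremum is `V(ρ)` for `BV(H,H)`. -/
def BVsetH (e : ℕ → H) (α : ℕ → ℝ) (μ : Measure H) (ρ : H → ℝ) : Set ℝ :=
  {r | ∃ (m : ℕ) (g : Fin m → H → ℝ) (Dg : Fin m → H → H) (l : Fin m → H),
    (∀ i, IsCb1 (g i) (Dg i)) ∧ (∀ i, memDA e α (l i)) ∧
    (∀ z, ‖∑ i, g i z • l i‖ ≤ 1) ∧
    r = ∫ z, Dstar e α g Dg l z * ρ z ∂μ}

section HahnBanachRiesz

variable {X : Type*} [TopologicalSpace X] [CompactSpace X]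

/-- A linear relation on `C(X)` dominated by `V · sup` is contained in a linear functional with the
same domination. -/
lemma exists_linearMap_extension_of_le_mul_sup [Nonempty X] {V : ℝ} (hV : 0 ≤ V)
    (S : Submodule ℝ (C(X, ℝ) × ℝ))
    (hS : ∀ F r, (F, r) ∈ S → ∀ s, (∀ x, F x ≤ s) → r ≤ V * s) :
    ∃ Λ : C(X, ℝ) →ₗ[ℝ] ℝ, (∀ F r, (F, r) ∈ S → Λ F = r) ∧
      ∀ F s, (∀ x, F x ≤ s) → Λ F ≤ V * s := by
  have hbdd : ∀ F : C(X, ℝ), BddAbove (Set.range F) := fun F =>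
    (isCompact_range F.continuous).bddAbove
  have hgraph : ∀ p ∈ S, p.1 = 0 → p.2 = 0 := by
    rintro ⟨F, r⟩ hp (rfl : F = 0)
    have h₁ := hS _ _ hp 0 (by simp)
    have h₂ := hS (-0) (-r) (S.neg_mem hp) 0 (by simp)
    simp only [mul_zero] at h₁ h₂
    exact le_antisymm h₁ (by linarith)
  have hmem : ∀ F r, (F, r) ∈ S → ∃ x : S.toLinearPMap.domain,
      (x : C(X, ℝ)) = F ∧ S.toLinearPMap x = r := by
    intro F r h
    rw [← Submodule.toLinearPMap_graph_eq S hgraph, LinearPMap.mem_graph_iff] at h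
    exact h
  obtain ⟨Λ, hΛ, hΛN⟩ := exists_extension_of_le_sublinear S.toLinearPMap
    (fun F => V * ⨆ x, F x)
    (fun a ha F => by
      have : (⨆ x, (a • F) x) = a * ⨆ x, F x := by
        simp only [ContinuousMap.smul_apply, smul_eq_mul]
        rw [Real.mul_iSup_of_nonneg ha.le]
      simp only [this]; ring)
    (fun F G => by
      rw [← mul_add]
      refine mul_le_mul_of_nonneg_left (ciSup_le fun x => ?_) hV
      exact add_le_add (le_ciSup (hbdd F) x) (le_ciSup (hbdd G) x))
    (fun x => hS _ _ (Submodule.mem_graph_toLinearPMap hgraph x) _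
      fun y => le_ciSup (hbdd _) y)
  refine ⟨Λ, fun F r h => ?_, fun F s hs => (hΛN F).trans ?_⟩
  · obtain ⟨x, rfl, rfl⟩ := hmem F r h
    exact hΛ x
  · exact mul_le_mul_of_nonneg_left (ciSup_le hs) hV

/-- A linear relation on `C(X)` dominated by `V · sup` is represented by a positive measure of
total mass `V`. -/
lemma exists_measure_of_le_mul_sup [T2Space X] [MeasurableSpace X] [BorelSpace X] [Nonempty X]
    {V : ℝ} (hV : 0 ≤ V) (S : Submodule ℝ (C(X, ℝ) × ℝ))
    (hS : ∀ F r, (F, r) ∈ S → ∀ s, (∀ x, F x ≤ s) → r ≤ V * s) :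
    ∃ M : Measure X, IsFiniteMeasure M ∧ M.real Set.univ = V ∧
      ∀ F r, (F, r) ∈ S → ∫ x, F x ∂M = r := by
  obtain ⟨Λ, hΛS, hΛ⟩ := exists_linearMap_extension_of_le_mul_sup hV S hS
  have hpos : ∀ F : C(X, ℝ), (∀ x, 0 ≤ F x) → 0 ≤ Λ F := fun F hF => by
    have := hΛ (-F) 0 (fun x => by simpa using hF x)
    rw [map_neg, mul_zero] at this
    linarith
  let Φ : CompactlySupportedContinuousMap X ℝ →ₚ[ℝ] ℝ :=
    PositiveLinearMap.mk₀
      { toFun := fun f => Λ f.toContinuousMap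
        map_add' := fun f g => map_add Λ f.toContinuousMap g.toContinuousMap
        map_smul' := fun a f => map_smul Λ a f.toContinuousMap }
      (fun f hf => hpos _ hf)
  have hint : ∀ F : C(X, ℝ), ∫ x, F x ∂(RealRMK.rieszMeasure Φ) = Λ F := fun F =>
    RealRMK.integral_rieszMeasure Φ ⟨F, HasCompactSupport.of_compactSpace _⟩
  refine ⟨RealRMK.rieszMeasure Φ, inferInstance, ?_, fun F r h => (hint F).trans (hΛS F r h)⟩
  have h₁ := hint 1
  simp only [ContinuousMap.one_apply, integral_const, smul_eq_mul, mul_one] at h₁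
  rw [h₁]
  have h₂ := hΛ 1 1 (by simp)
  have h₃ := hΛ (-1) (-1) (by simp)
  rw [map_neg] at h₃
  linarith

end HahnBanachRiesz

section GaussianIntegrability

/-- A Young-type inequality for the pair `A_{1/2}`, `t ↦ t exp(t²)`. -/
lemma mul_le_A12_add {a b : ℝ} (ha : 0 ≤ a) (hb : 0 ≤ b) :
    a * b ≤ 2 * A12 a + 2 * (b * Real.exp (b ^ 2)) := by
  have hcont : ContinuousOn (fun s : ℝ => √(Real.log (1 + s))) (Set.Ici 0) := by
    refine Real.continuous_sqrt.comp_continuousOn (ContinuousOn.log (by fun_prop) fun x hx => ?_)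
    have : (0:ℝ) ≤ x := hx
    positivity
  have hint : ∀ u v : ℝ, 0 ≤ u → 0 ≤ v →
      IntervalIntegrable (fun s : ℝ => √(Real.log (1 + s))) volume u v := fun u v hu hv =>
    (hcont.mono fun x hx => (le_inf hu hv).trans hx.1).intervalIntegrable
  have hA : a / 2 * √(Real.log (1 + a / 2)) ≤ A12 a := by
    have h₁ : A12 a = (∫ s in (0:ℝ)..(a/2), √(Real.log (1 + s)))
        + ∫ s in (a/2)..a, √(Real.log (1 + s)) := by
      rw [A12, intervalIntegral.integral_add_adjacent_intervals] <;> apply hint <;> linarith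
    have h₂ : 0 ≤ ∫ s in (0:ℝ)..(a/2), √(Real.log (1 + s)) :=
      intervalIntegral.integral_nonneg (by linarith) fun _ _ => Real.sqrt_nonneg _
    have h₃ : ∫ _ in (a/2)..a, √(Real.log (1 + a / 2)) ≤ ∫ s in (a/2)..a, √(Real.log (1 + s)) := by
      refine intervalIntegral.integral_mono_on (by linarith) (by simp)
        (hint _ _ (by linarith) ha) fun x hx => ?_
      have := hx.1
      gcongr
    rw [intervalIntegral.integral_const, smul_eq_mul] at h₃
    rw [h₁]
    linarith
  have hA0 : 0 ≤ A12 a := le_trans (by positivity) hA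
  rcases le_or_gt (a / 2) (Real.exp (b ^ 2)) with h | h
  · have : a * b ≤ 2 * Real.exp (b ^ 2) * b := by gcongr; linarith
    linarith
  · have hb' : b ≤ √(Real.log (1 + a / 2)) := by
      refine Real.le_sqrt_of_sq_le ?_
      rw [Real.le_log_iff_exp_le (by positivity)]
      linarith
    have : a / 2 * b ≤ a / 2 * √(Real.log (1 + a / 2)) := by gcongr
    have h0 : 0 ≤ b * Real.exp (b ^ 2) := by positivity
    linarith

variable {H : Type*} [NormedAddCommGroup H] [InnerProductSpace ℝ H] [CompleteSpace H]
  [SecondCountableTopology H] [MeasurableSpace H] [BorelSpace H]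

/-- Against a Gaussian measure, the norm is integrable with respect to `ρ μ` for `ρ` in the Orlicz
class of `A_{1/2}`. -/
lemma integrable_norm_mul_of_integrable_A12 {μ : Measure H} [ProbabilityTheory.IsGaussian μ]
    {ρ : H → ℝ} (hρmeas : Measurable ρ) (hρpos : ∀ z, 0 ≤ ρ z)
    (hρA12 : Integrable (fun z => A12 |ρ z|) μ) :
    Integrable (fun z => ‖z‖ * ρ z) μ := by
  obtain ⟨C, hC, hCint⟩ := ProbabilityTheory.IsGaussian.exists_integrable_exp_sq μ
  set k := √(C / 2) with hk
  have hk0 : 0 < k := by positivity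
  have hk2 : k ^ 2 = C / 2 := Real.sq_sqrt (by positivity)
  have hdom : Integrable (fun z => k⁻¹ * (2 * A12 |ρ z| + 2 * Real.exp (C * ‖z‖ ^ 2))) μ :=
    ((hρA12.const_mul 2).add (hCint.const_mul 2)).const_mul _
  refine hdom.mono' (by fun_prop) (ae_of_all _ fun z => ?_)
  have hz : 0 ≤ ‖z‖ * ρ z := mul_nonneg (norm_nonneg _) (hρpos z)
  rw [Real.norm_of_nonneg hz, abs_of_nonneg (hρpos z), le_inv_mul_iff₀ hk0]
  have h₁ := mul_le_A12_add (hρpos z) (b := k * ‖z‖) (by positivity)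
  have h₂ : k * ‖z‖ * Real.exp ((k * ‖z‖) ^ 2) ≤ Real.exp (C * ‖z‖ ^ 2) := by
    have : C * ‖z‖ ^ 2 = (k * ‖z‖) ^ 2 + (k * ‖z‖) ^ 2 := by rw [mul_pow, hk2]; ring
    rw [this, Real.exp_add]
    gcongr
    nlinarith [Real.add_one_le_exp ((k * ‖z‖) ^ 2), sq_nonneg (k * ‖z‖ - 1)]
  linarith

end GaussianIntegrability

section Cutoff

variable {E : Type*} [NormedAddCommGroup E]

/-- The `C¹` cutoff `z ↦ (1 - ‖z‖² / R²)₊²`. -/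
def cutoff (R : ℝ) (z : E) : ℝ := (max 0 (1 - ‖z‖ ^ 2 / R ^ 2)) ^ 2

lemma cutoff_nonneg (R : ℝ) (z : E) : 0 ≤ cutoff R z := sq_nonneg _

lemma cutoff_le_one (R : ℝ) (z : E) : cutoff R z ≤ 1 := by
  refine pow_le_one₀ (le_max_left _ _) (max_le zero_le_one ?_)
  have : 0 ≤ ‖z‖ ^ 2 / R ^ 2 := by positivity
  linarith

lemma cutoff_eq_zero {R : ℝ} (hR : 0 < R) {z : E} (hz : R ≤ ‖z‖) : cutoff R z = 0 := by
  have : 1 ≤ ‖z‖ ^ 2 / R ^ 2 := by rw [one_le_div (by positivity)]; gcongr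
  rw [cutoff, max_eq_left (by linarith)]
  simp

lemma tendsto_cutoff (z : E) :
    Tendsto (fun n : ℕ => cutoff ((n : ℝ) + 1) z) atTop (nhds 1) := by
  have h₁ : Tendsto (fun n : ℕ => 1 - ‖z‖ ^ 2 / ((n : ℝ) + 1) ^ 2) atTop (nhds (1 - 0)) := by
    refine tendsto_const_nhds.sub (tendsto_const_nhds.div_atTop ?_)
    exact (tendsto_pow_atTop two_ne_zero).comp
      (tendsto_atTop_add_const_right _ 1 tendsto_natCast_atTop_atTop)
  have h₂ := ((tendsto_const_nhds (x := (0:ℝ))).max h₁).pow 2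
  simpa [cutoff] using h₂

end Cutoff

section TestFunctions

variable {H : Type*} [NormedAddCommGroup H] [InnerProductSpace ℝ H]

namespace IsCb1

variable {g g' : H → ℝ} {Dg Dg' : H → H}

lemma continuous (h : IsCb1 g Dg) : Continuous g :=
  continuous_iff_continuousAt.2 fun x => (h.1 x).continuousAt

protected lemma zero : IsCb1 (0 : H → ℝ) 0 :=
  ⟨fun x => by simpa using! hasFDerivAt_const (0 : ℝ) x, continuous_zero,
    ⟨0, by simp⟩, ⟨0, by simp⟩⟩

lemma add (h : IsCb1 g Dg) (h' : IsCb1 g' Dg') : IsCb1 (g + g') (Dg + Dg') := by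
  obtain ⟨h₁, h₂, ⟨C, hC⟩, ⟨D, hD⟩⟩ := h
  obtain ⟨h₁', h₂', ⟨C', hC'⟩, ⟨D', hD'⟩⟩ := h'
  refine ⟨fun x => ?_, h₂.add h₂', ⟨C + C', fun x => ?_⟩, ⟨D + D', fun x => ?_⟩⟩
  · simpa using (h₁ x).add (h₁' x)
  · exact (abs_add_le _ _).trans (add_le_add (hC x) (hC' x))
  · exact (norm_add_le _ _).trans (add_le_add (hD x) (hD' x))

lemma mul (h : IsCb1 g Dg) (h' : IsCb1 g' Dg') :
    IsCb1 (fun x => g x * g' x) (fun x => g x • Dg' x + g' x • Dg x) := by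
  have hc := h.continuous
  have hc' := h'.continuous
  obtain ⟨h₁, h₂, ⟨C, hC⟩, ⟨D, hD⟩⟩ := h
  obtain ⟨h₁', h₂', ⟨C', hC'⟩, ⟨D', hD'⟩⟩ := h'
  refine ⟨fun x => ?_, by fun_prop, ⟨C * C', fun x => ?_⟩, ⟨C * D' + C' * D, fun x => ?_⟩⟩
  · simpa using! (h₁ x).mul (h₁' x)
  · rw [abs_mul]
    exact mul_le_mul (hC x) (hC' x) (abs_nonneg _) ((abs_nonneg _).trans (hC x))
  · refine (norm_add_le _ _).trans (add_le_add ?_ ?_) <;> rw [norm_smul, Real.norm_eq_abs]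
    · exact mul_le_mul (hC x) (hD' x) (norm_nonneg _) ((abs_nonneg _).trans (hC x))
    · exact mul_le_mul (hC' x) (hD x) (norm_nonneg _) ((abs_nonneg _).trans (hC' x))

lemma const_smul (a : ℝ) (h : IsCb1 g Dg) : IsCb1 (a • g) (a • Dg) := by
  obtain ⟨h₁, h₂, ⟨C, hC⟩, ⟨D, hD⟩⟩ := h
  refine ⟨fun x => ?_, h₂.const_smul a, ⟨|a| * C, fun x => ?_⟩, ⟨|a| * D, fun x => ?_⟩⟩
  · simpa using (h₁ x).const_smul a
  · rw [Pi.smul_apply, smul_eq_mul, abs_mul]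
    exact mul_le_mul_of_nonneg_left (hC x) (abs_nonneg a)
  · rw [Pi.smul_apply, norm_smul, Real.norm_eq_abs]
    exact mul_le_mul_of_nonneg_left (hD x) (abs_nonneg a)

lemma comp_symmetric (h : IsCb1 g Dg) {P : H →L[ℝ] H} (hP : ∀ x y, ⟪P x, y⟫ = ⟪x, P y⟫) :
    IsCb1 (fun x => g (P x)) (fun x => P (Dg (P x))) := by
  obtain ⟨h₁, h₂, ⟨C, hC⟩, ⟨D, hD⟩⟩ := h
  refine ⟨fun x => ?_, by fun_prop, ⟨C, fun x => hC _⟩, ⟨‖P‖ * D, fun x => ?_⟩⟩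
  · have := (h₁ (P x)).comp x P.hasFDerivAt
    convert! this using 1
    ext y
    simp [hP]
  · exact (P.le_opNorm _).trans (mul_le_mul_of_nonneg_left (hD _) (norm_nonneg _))

end IsCb1

/-- The gradient of `cutoff R`. -/
def gradCutoff (R : ℝ) (z : H) : H := (-(4 / R ^ 2) * max 0 (1 - ‖z‖ ^ 2 / R ^ 2)) • z

lemma hasDerivAt_sq_max_zero (u : ℝ) : HasDerivAt (fun u : ℝ => (max 0 u) ^ 2) (2 * max 0 u) u := by
  rcases lt_trichotomy u 0 with hu | rfl | hu
  · have : (fun u : ℝ => (max 0 u) ^ 2) =ᶠ[nhds u] fun _ => 0 := by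
      filter_upwards [gt_mem_nhds hu] with v hv
      simp [max_eq_left hv.le]
    rw [max_eq_left hu.le, mul_zero]
    exact (hasDerivAt_const u (0:ℝ)).congr_of_eventuallyEq this
  · rw [max_self, mul_zero, hasDerivAt_iff_isLittleO_nhds_zero]
    refine Asymptotics.IsBigO.trans_isLittleO (g := fun h : ℝ => h ^ 2) ?_ ?_
    · refine Asymptotics.isBigO_of_le _ fun h => ?_
      simp only [zero_add, max_self, smul_zero, sub_zero, ne_eq, OfNat.ofNat_ne_zero,
        not_false_eq_true, zero_pow, norm_pow]
      gcongr
      rw [Real.norm_of_nonneg (le_max_left _ _)]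
      exact max_le (norm_nonneg _) (le_abs_self _)
    · exact Asymptotics.isLittleO_pow_id one_lt_two
  · have : (fun u : ℝ => (max 0 u) ^ 2) =ᶠ[nhds u] fun u => u ^ 2 := by
      filter_upwards [lt_mem_nhds hu] with v hv
      rw [max_eq_right hv.le]
    rw [max_eq_right hu.le]
    simpa using (hasDerivAt_pow 2 u).congr_of_eventuallyEq this

lemma norm_gradCutoff_le {R : ℝ} (hR : 0 < R) (z : H) : ‖gradCutoff R z‖ ≤ 4 / R := by
  rcases le_or_gt R ‖z‖ with hz | hz
  · have : 1 ≤ ‖z‖ ^ 2 / R ^ 2 := by rw [one_le_div (by positivity)]; gcongr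
    rw [gradCutoff, max_eq_left (by linarith)]
    simp only [mul_zero, zero_smul, norm_zero]
    positivity
  · have h₁ : max 0 (1 - ‖z‖ ^ 2 / R ^ 2) ≤ 1 := by
      refine max_le zero_le_one ?_
      have : 0 ≤ ‖z‖ ^ 2 / R ^ 2 := by positivity
      linarith
    rw [gradCutoff, norm_smul, norm_mul, norm_neg, Real.norm_of_nonneg (by positivity),
      Real.norm_of_nonneg (le_max_left _ _)]
    calc 4 / R ^ 2 * max 0 (1 - ‖z‖ ^ 2 / R ^ 2) * ‖z‖ ≤ 4 / R ^ 2 * 1 * R := by gcongr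
      _ = 4 / R := by field_simp

lemma isCb1_cutoff {R : ℝ} (hR : 0 < R) : IsCb1 (cutoff R : H → ℝ) (gradCutoff R) := by
  refine ⟨fun x => ?_, ?_, ⟨1, fun x => ?_⟩, ⟨4 / R, norm_gradCutoff_le hR⟩⟩
  · have h₁ : HasFDerivAt (fun z : H => 1 - ‖z‖ ^ 2 / R ^ 2) (-((R ^ 2)⁻¹ • (2 • innerSL ℝ x))) x := by
      simpa [div_eq_inv_mul] using
        (((hasStrictFDerivAt_norm_sq x).hasFDerivAt).const_mul ((R ^ 2)⁻¹)).const_sub 1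
    have h₂ := (hasDerivAt_sq_max_zero (1 - ‖x‖ ^ 2 / R ^ 2)).comp_hasFDerivAt x h₁
    convert! h₂ using 1
    ext y
    simp only [gradCutoff, map_smul, smul_apply, neg_apply, innerSL_apply_apply,
      smul_eq_mul, nsmul_eq_mul, smul_neg]
    push_cast
    ring
  · unfold gradCutoff
    fun_prop
  · rw [abs_of_nonneg (cutoff_nonneg _ _)]
    exact cutoff_le_one _ _

lemma tendsto_gradCutoff (z : H) :
    Tendsto (fun n : ℕ => gradCutoff ((n : ℝ) + 1) z) atTop (nhds 0) := by
  refine squeeze_zero_norm (fun n => norm_gradCutoff_le (by positivity) z) ?_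
  exact tendsto_const_nhds.div_atTop
      (tendsto_atTop_add_const_right _ 1 tendsto_natCast_atTop_atTop)

end TestFunctions

section PartialSums

variable {H : Type*} [NormedAddCommGroup H] [InnerProductSpace ℝ H] {e : ℕ → H}

/-- The orthogonal projection onto the span of the first `n` vectors of `e`. -/
def truncation (e : ℕ → H) (n : ℕ) : H →L[ℝ] H :=
  ∑ j ∈ Finset.range n, (innerSL ℝ (e j)).smulRight (e j)

lemma truncation_apply (e : ℕ → H) (n : ℕ) (x : H) :
    truncation e n x = ∑ j ∈ Finset.range n, ⟪x, e j⟫ • e j := by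
  simp [truncation, real_inner_comm]

lemma truncation_symm (e : ℕ → H) (n : ℕ) (x y : H) :
    ⟪truncation e n x, y⟫ = ⟪x, truncation e n y⟫ := by
  simp only [truncation_apply, sum_inner, inner_sum, real_inner_smul_left, real_inner_smul_right]
  refine Finset.sum_congr rfl fun j _ => ?_
  rw [real_inner_comm y (e j)]
  ring

lemma norm_sq_sum_smul (hON : Orthonormal ℝ e) (n : ℕ) (a : ℕ → ℝ) :
    ‖∑ j ∈ Finset.range n, a j • e j‖ ^ 2 = ∑ j ∈ Finset.range n, a j ^ 2 := by
  rw [← real_inner_self_eq_norm_sq, hON.inner_sum]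
  simp [sq]

lemma inner_sum_smul (hON : Orthonormal ℝ e) (n : ℕ) (a : ℕ → ℝ) (i : ℕ) :
    ⟪∑ j ∈ Finset.range n, a j • e j, e i⟫ = if i < n then a i else 0 := by
  simp [sum_inner, real_inner_smul_left, orthonormal_iff_ite.1 hON]

lemma norm_truncation_le (hON : Orthonormal ℝ e) (n : ℕ) (x : H) : ‖truncation e n x‖ ≤ ‖x‖ := by
  refine le_of_sq_le_sq ?_ (norm_nonneg _)
  rw [truncation_apply, norm_sq_sum_smul hON]
  simpa [real_inner_comm] using hON.sum_inner_products_le x (s := Finset.range n)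

lemma tendsto_truncation [CompleteSpace H] (hON : Orthonormal ℝ e)
    (hTot : (Submodule.span ℝ (Set.range e)).topologicalClosure = ⊤) (x : H) :
    Tendsto (fun n => truncation e n x) atTop (nhds x) := by
  have h := (HilbertBasis.mk hON hTot.ge).hasSum_repr x
  simp only [HilbertBasis.repr_apply_apply, HilbertBasis.coe_mk] at h
  simpa [truncation_apply, real_inner_comm] using h.tendsto_sum_nat

lemma summable_smul_iff [CompleteSpace H] (hON : Orthonormal ℝ e) (a : ℕ → ℝ) :
    (Summable fun j => a j • e j) ↔ Summable fun j => a j ^ 2 := by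
  simpa using hON.orthogonalFamily.summable_iff_norm_sq_summable a

lemma Aop_basis (hON : Orthonormal ℝ e) (α : ℕ → ℝ) (i : ℕ) : Aop e α (e i) = α i • e i := by
  rw [Aop, tsum_eq_single i]
  · simp [hON.1 i]
  · intro j hj
    simp [hON.2 hj.symm]

lemma tendsto_Aop [CompleteSpace H] (hON : Orthonormal ℝ e) {α : ℕ → ℝ} {l : H}
    (hl : memDA e α l) :
    Tendsto (fun n => ∑ j ∈ Finset.range n, ⟪l, e j⟫ • α j • e j) atTop (nhds (Aop e α l)) := by
  have : Summable fun j => (α j * ⟪l, e j⟫) • e j := by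
    rw [summable_smul_iff hON]
    simpa [mul_pow, memDA] using hl
  simpa [Aop, smul_smul, mul_comm] using this.hasSum.tendsto_sum_nat

end PartialSums

section IntegrationByPartsFunctional

variable {H : Type*} [NormedAddCommGroup H] [InnerProductSpace ℝ H] [MeasurableSpace H]

/-- The functional `∫ (-⟨l, Dg(z)⟩ + 2 g(z) ⟨a, z⟩) ρ(z) μ(dz)`; for `a = A l` this is
`∫ D*(g l) ρ dμ`. -/
def ibp (μ : Measure H) (ρ : H → ℝ) (g : H → ℝ) (Dg : H → H) (l a : H) : ℝ :=
  ∫ z, (-⟪l, Dg z⟫ + 2 * g z * ⟪a, z⟫) * ρ z ∂μ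

variable [BorelSpace H] {μ : Measure H} {ρ : H → ℝ}
  {g g' : H → ℝ} {Dg Dg' : H → H}

omit [MeasurableSpace H] [BorelSpace H] in
lemma norm_ibp_integrand_le {x : ℝ} {l a v z : H} {C L r : ℝ} (hC : |x| ≤ C) (hD : ‖v‖ ≤ C)
    (hl : ‖l‖ ≤ L) (ha : ‖a‖ ≤ L) (hr : 0 ≤ r) :
    ‖(-⟪l, v⟫ + 2 * x * ⟪a, z⟫) * r‖ ≤ C * L * r + 2 * C * L * (‖z‖ * r) := by
  have hL : 0 ≤ L := (norm_nonneg _).trans hl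
  have hC0 : 0 ≤ C := (abs_nonneg _).trans hC
  rw [norm_mul, Real.norm_of_nonneg hr]
  have h₁ : |⟪l, v⟫| ≤ L * C := (abs_real_inner_le_norm _ _).trans (by gcongr)
  have h₂ : |⟪a, z⟫| ≤ L * ‖z‖ := (abs_real_inner_le_norm _ _).trans (by gcongr)
  have h₃ : ‖-⟪l, v⟫ + 2 * x * ⟪a, z⟫‖ ≤ L * C + 2 * C * (L * ‖z‖) := by
    refine (norm_add_le _ _).trans ?_
    rw [norm_neg, norm_mul, norm_mul]
    simp only [Real.norm_eq_abs, Nat.abs_ofNat]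
    gcongr
  calc _ ≤ (L * C + 2 * C * (L * ‖z‖)) * r := by gcongr
    _ = _ := by ring

lemma integrable_ibp_integrand (hρpos : ∀ z, 0 ≤ ρ z) (hρ : Integrable ρ μ)
    (hρn : Integrable (fun z => ‖z‖ * ρ z) μ) (hg : IsCb1 g Dg) (l a : H) :
    Integrable (fun z => (-⟪l, Dg z⟫ + 2 * g z * ⟪a, z⟫) * ρ z) μ := by
  have hgc := hg.continuous
  obtain ⟨-, hDc, ⟨C, hC⟩, ⟨D, hD⟩⟩ := hg
  have hdom := (hρ.const_mul (max C D * max ‖l‖ ‖a‖)).add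
    (hρn.const_mul (2 * max C D * max ‖l‖ ‖a‖))
  refine hdom.mono' ?_ (ae_of_all _ fun z => norm_ibp_integrand_le ((hC z).trans (le_max_left _ _))
    ((hD z).trans (le_max_right _ _)) (le_max_left _ _) (le_max_right _ _) (hρpos z))
  exact (by fun_prop : Continuous fun z => -⟪l, Dg z⟫ + 2 * g z * ⟪a, z⟫).aestronglyMeasurable.mul
    hρ.1

lemma integral_Dstar_mul {e : ℕ → H} {α : ℕ → ℝ} (hρpos : ∀ z, 0 ≤ ρ z) (hρ : Integrable ρ μ)
    (hρn : Integrable (fun z => ‖z‖ * ρ z) μ) {k : ℕ} {g : Fin k → H → ℝ} {Dg : Fin k → H → H}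
    {l : Fin k → H} (hg : ∀ i, IsCb1 (g i) (Dg i)) :
    ∫ z, Dstar e α g Dg l z * ρ z ∂μ = ∑ i, ibp μ ρ (g i) (Dg i) (l i) (Aop e α (l i)) := by
  simp only [Dstar, Finset.sum_mul, ibp]
  exact integral_finsetSum _ fun i _ => integrable_ibp_integrand hρpos hρ hρn (hg i) _ _

lemma ibp_add (hρpos : ∀ z, 0 ≤ ρ z) (hρ : Integrable ρ μ)
    (hρn : Integrable (fun z => ‖z‖ * ρ z) μ) (hg : IsCb1 g Dg) (hg' : IsCb1 g' Dg') (l a : H) :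
    ibp μ ρ (g + g') (Dg + Dg') l a = ibp μ ρ g Dg l a + ibp μ ρ g' Dg' l a := by
  rw [ibp, ibp, ibp, ← integral_add (integrable_ibp_integrand hρpos hρ hρn hg l a)
    (integrable_ibp_integrand hρpos hρ hρn hg' l a)]
  congr with z
  simp only [Pi.add_apply, inner_add_right]
  ring

omit [BorelSpace H] in
lemma ibp_const_smul (c : ℝ) (l a : H) :
    ibp μ ρ (c • g) (c • Dg) l a = c * ibp μ ρ g Dg l a := by
  rw [ibp, ibp, ← integral_const_mul]
  congr with z
  simp only [Pi.smul_apply, real_inner_smul_right, smul_eq_mul]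
  ring

lemma sum_mul_ibp (hρpos : ∀ z, 0 ≤ ρ z) (hρ : Integrable ρ μ)
    (hρn : Integrable (fun z => ‖z‖ * ρ z) μ) (hg : IsCb1 g Dg) (s : Finset ℕ) (x : ℕ → ℝ)
    (l a : ℕ → H) :
    ∑ j ∈ s, x j * ibp μ ρ g Dg (l j) (a j) =
      ibp μ ρ g Dg (∑ j ∈ s, x j • l j) (∑ j ∈ s, x j • a j) := by
  simp only [ibp, ← integral_const_mul]
  rw [← integral_finsetSum _ fun i _ =>
    (integrable_ibp_integrand hρpos hρ hρn hg _ _).const_mul _]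
  congr with z
  simp only [sum_inner, real_inner_smul_left, ← Finset.sum_neg_distrib, Finset.mul_sum,
    ← Finset.sum_add_distrib, Finset.sum_mul]
  exact Finset.sum_congr rfl fun j _ => by ring

lemma tendsto_ibp (hρpos : ∀ z, 0 ≤ ρ z) (hρ : Integrable ρ μ)
    (hρn : Integrable (fun z => ‖z‖ * ρ z) μ) {gn : ℕ → H → ℝ} {Dgn : ℕ → H → H} {ln an : ℕ → H}
    {l a : H} {C : ℝ} (hgn : ∀ n, IsCb1 (gn n) (Dgn n)) (hC : ∀ n z, |gn n z| ≤ C)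
    (hD : ∀ n z, ‖Dgn n z‖ ≤ C) (hg : ∀ z, Tendsto (fun n => gn n z) atTop (nhds (g z)))
    (hDg : ∀ z, Tendsto (fun n => Dgn n z) atTop (nhds (Dg z)))
    (hl : Tendsto ln atTop (nhds l)) (ha : Tendsto an atTop (nhds a)) :
    Tendsto (fun n => ibp μ ρ (gn n) (Dgn n) (ln n) (an n)) atTop (nhds (ibp μ ρ g Dg l a)) := by
  obtain ⟨L, hL⟩ := hl.norm.bddAbove_range
  obtain ⟨L', hL'⟩ := ha.norm.bddAbove_range
  have hL : ∀ n, ‖ln n‖ ≤ max L L' := fun n => (hL ⟨n, rfl⟩).trans (le_max_left _ _)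
  have hL' : ∀ n, ‖an n‖ ≤ max L L' := fun n => (hL' ⟨n, rfl⟩).trans (le_max_right _ _)
  refine tendsto_integral_of_dominated_convergence
    (fun z => C * max L L' * ρ z + 2 * C * max L L' * (‖z‖ * ρ z))
    (fun n => (integrable_ibp_integrand hρpos hρ hρn (hgn n) _ _).1)
    ((hρ.const_mul _).add (hρn.const_mul _))
    (fun n => ae_of_all _ fun z =>
      norm_ibp_integrand_le (hC n z) (hD n z) (hL n) (hL' n) (hρpos z))
    (ae_of_all _ fun z => ?_)
  exact ((hl.inner (hDg z)).neg.add
    ((tendsto_const_nhds.mul (hg z)).mul (ha.inner tendsto_const_nhds))).mul_const _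

lemma tendsto_sum_mul_ibp_basis [CompleteSpace H] {e : ℕ → H} {α : ℕ → ℝ}
    (hON : Orthonormal ℝ e) (hTot : (Submodule.span ℝ (Set.range e)).topologicalClosure = ⊤)
    (hρpos : ∀ z, 0 ≤ ρ z) (hρ : Integrable ρ μ)
    (hρn : Integrable (fun z => ‖z‖ * ρ z) μ) (hg : IsCb1 g Dg) {l : H} (hl : memDA e α l) :
    Tendsto (fun N => ∑ j ∈ Finset.range N, ⟪l, e j⟫ * ibp μ ρ g Dg (e j) (α j • e j)) atTop
      (nhds (ibp μ ρ g Dg l (Aop e α l))) := by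
  simp only [sum_mul_ibp hρpos hρ hρn hg]
  obtain ⟨-, -, ⟨C, hC⟩, ⟨D, hD⟩⟩ := id hg
  refine tendsto_ibp hρpos hρ hρn (C := max C D) (fun _ => hg)
    (fun _ z => (hC z).trans (le_max_left _ _)) (fun _ z => (hD z).trans (le_max_right _ _))
    (fun _ => tendsto_const_nhds) (fun _ => tendsto_const_nhds) ?_ (tendsto_Aop hON hl)
  simpa [truncation_apply] using tendsto_truncation hON hTot l

/-- The gradient of `z ↦ cutoff R z * g z`. -/
def gradCutoffMul (R : ℝ) (g : H → ℝ) (Dg : H → H) (z : H) : H :=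
  cutoff R z • Dg z + g z • gradCutoff R z

omit [MeasurableSpace H] [BorelSpace H] in
lemma IsCb1.cutoff_mul (hg : IsCb1 g Dg) {R : ℝ} (hR : 0 < R) :
    IsCb1 (fun z => cutoff R z * g z) (gradCutoffMul R g Dg) :=
  (isCb1_cutoff hR).mul hg

lemma tendsto_ibp_cutoff (hρpos : ∀ z, 0 ≤ ρ z) (hρ : Integrable ρ μ)
    (hρn : Integrable (fun z => ‖z‖ * ρ z) μ) (hg : IsCb1 g Dg) (l a : H) :
    Tendsto (fun n : ℕ => ibp μ ρ (fun z => cutoff ((n : ℝ) + 1) z * g z)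
      (gradCutoffMul ((n : ℝ) + 1) g Dg) l a) atTop (nhds (ibp μ ρ g Dg l a)) := by
  obtain ⟨-, -, ⟨C, hC⟩, ⟨D, hD⟩⟩ := id hg
  have hC0 : 0 ≤ C := (abs_nonneg _).trans (hC 0)
  have hD0 : 0 ≤ D := (norm_nonneg _).trans (hD 0)
  refine tendsto_ibp hρpos hρ hρn (C := D + C * 4)
    (fun n => hg.cutoff_mul (by positivity)) (fun n z => ?_) (fun n z => ?_)
    (fun z => ?_) (fun z => ?_) tendsto_const_nhds tendsto_const_nhds
  · rw [abs_mul, abs_of_nonneg (cutoff_nonneg _ _)]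
    calc _ ≤ 1 * C := mul_le_mul (cutoff_le_one _ _) (hC z) (abs_nonneg _) zero_le_one
      _ ≤ _ := by linarith
  · have h₁ : ‖gradCutoff ((n : ℝ) + 1) z‖ ≤ 4 :=
      (norm_gradCutoff_le (by positivity) z).trans
        (div_le_self (by norm_num) (by linarith [n.cast_nonneg (α := ℝ)]))
    refine (norm_add_le _ _).trans (add_le_add ?_ ?_) <;> rw [norm_smul, Real.norm_eq_abs]
    · rw [abs_of_nonneg (cutoff_nonneg _ _)]
      calc _ ≤ 1 * D := mul_le_mul (cutoff_le_one _ _) (hD z) (norm_nonneg _) zero_le_one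
        _ = D := one_mul D
    · exact mul_le_mul (hC z) h₁ (norm_nonneg _) hC0
  · simpa using (tendsto_cutoff z).mul_const (g z)
  · simpa [gradCutoffMul] using ((tendsto_cutoff z).smul_const (Dg z)).add
      ((tendsto_gradCutoff z).const_smul (g z))

lemma tendsto_ibp_truncation [CompleteSpace H] {e : ℕ → H}
    (hON : Orthonormal ℝ e) (hTot : (Submodule.span ℝ (Set.range e)).topologicalClosure = ⊤)
    (hρpos : ∀ z, 0 ≤ ρ z) (hρ : Integrable ρ μ)
    (hρn : Integrable (fun z => ‖z‖ * ρ z) μ) (hg : IsCb1 g Dg) (l a : H) :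
    Tendsto (fun n : ℕ => ibp μ ρ (fun z => g (truncation e n z))
      (fun z => truncation e n (Dg (truncation e n z))) l a) atTop (nhds (ibp μ ρ g Dg l a)) := by
  have hgc := hg.continuous
  obtain ⟨-, hDc, ⟨C, hC⟩, ⟨D, hD⟩⟩ := id hg
  refine tendsto_ibp hρpos hρ hρn (C := max C D)
    (fun n => hg.comp_symmetric (truncation_symm e n))
    (fun n z => (hC _).trans (le_max_left _ _))
    (fun n z => (norm_truncation_le hON n _).trans ((hD _).trans (le_max_right _ _)))
    (fun z => ?_) (fun z => ?_) tendsto_const_nhds tendsto_const_nhds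
  · exact (hgc.tendsto z).comp (tendsto_truncation hON hTot z)
  · have h₁ : Tendsto (fun n => Dg (truncation e n z)) atTop (nhds (Dg z)) :=
      (hDc.tendsto z).comp (tendsto_truncation hON hTot z)
    have h₂ : Tendsto (fun n => truncation e n (Dg (truncation e n z) - Dg z)) atTop (nhds 0) :=
      squeeze_zero_norm (fun n => norm_truncation_le hON n _)
        (by simpa using (h₁.sub_const (Dg z)).norm)
    simpa using h₂.add (tendsto_truncation hON hTot (Dg z))

end IntegrationByPartsFunctional

section Compactification

/-- The unit ball of `ℓ²`, with the topology of coordinatewise convergence. -/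
def sqBall : Set (ℕ → ℝ) := {b | ∀ N, ∑ j ∈ Finset.range N, b j ^ 2 ≤ 1}

lemma abs_le_one_of_mem_sqBall {b : ℕ → ℝ} (hb : b ∈ sqBall) (j : ℕ) : |b j| ≤ 1 := by
  rw [← sq_le_one_iff_abs_le_one]
  exact (Finset.single_le_sum (f := fun i => b i ^ 2) (fun i _ => sq_nonneg _)
    (Finset.self_mem_range_succ j)).trans (hb (j + 1))

lemma isClosed_sqBall : IsClosed sqBall := by
  simp only [sqBall, Set.ofPred_forall]
  exact isClosed_iInter fun N => isClosed_le (by fun_prop) continuous_const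

instance : CompactSpace sqBall := by
  rw [← isCompact_iff_compactSpace]
  refine (isCompact_univ_pi fun _ : ℕ => isCompact_Icc (a := (-1 : ℝ)) (b := 1)).of_isClosed_subset
    isClosed_sqBall fun b hb j _ => abs_le.1 (abs_le_one_of_mem_sqBall hb j)

instance : PolishSpace sqBall := isClosed_sqBall.polishSpace

instance : Nonempty sqBall := ⟨0, fun N => by simp⟩

lemma sum_mul_le_one_of_mem_sqBall {b : ℕ → ℝ} (hb : b ∈ sqBall) {N : ℕ} {x : ℕ → ℝ}
    (hx : ∑ j ∈ Finset.range N, x j ^ 2 ≤ 1) : ∑ j ∈ Finset.range N, x j * b j ≤ 1 := by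
  have h := Finset.sum_mul_sq_le_sq_mul_sq (Finset.range N) x b
  refine (abs_le_one_iff_mul_self_le_one.2 ?_ |> (le_abs_self _).trans)
  rw [← sq]
  exact h.trans (mul_le_one₀ hx (Finset.sum_nonneg fun _ _ => sq_nonneg _) (hb N))

/-- The truncation of an extended real number to `[-R, R]`. -/
def clampReal (R : ℝ) (x : EReal) : ℝ := (max (-R : EReal) (min R x)).toReal

lemma clampReal_coe (R x : ℝ) : clampReal R (x : EReal) = max (-R) (min R x) := by
  rw [clampReal]
  norm_cast

lemma continuous_clampReal (R : ℝ) : Continuous (clampReal R) := by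
  refine EReal.continuousOn_toReal.comp_continuous (by fun_prop) fun x => ?_
  simp only [Set.mem_compl_iff, Set.mem_insert_iff, Set.mem_singleton_iff, not_or]
  constructor
  · refine ne_of_gt (lt_of_lt_of_le ?_ (le_max_left _ _))
    exact_mod_cast EReal.bot_lt_coe (-R)
  · refine ne_of_lt (max_lt ?_ (lt_of_le_of_lt (min_le_left _ _) (EReal.coe_lt_top R)))
    exact_mod_cast EReal.coe_lt_top (-R)

lemma eq_coe_clampReal {R : ℝ} {x : EReal} (h : |clampReal R x| < R) :
    x = (clampReal R x : EReal) := by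
  have hR : 0 < R := (abs_nonneg _).trans_lt h
  induction x with
  | bot =>
    have : clampReal R ⊥ = -R := by simp [clampReal]
    rw [this, abs_neg, abs_of_pos hR] at h
    exact absurd h (lt_irrefl _)
  | top =>
    have : clampReal R ⊤ = R := by
      have : (-R : EReal) ≤ R := by exact_mod_cast (by linarith : -R ≤ R)
      simp [clampReal, max_eq_right this]
    rw [this, abs_of_pos hR] at h
    exact absurd h (lt_irrefl _)
  | coe x =>
    rw [clampReal_coe, abs_lt] at h
    rw [clampReal_coe]
    congr 1
    rcases le_total R x with hx | hx
    · rw [min_eq_left hx, max_eq_right (by linarith)] at h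
      exact absurd h.2 (lt_irrefl _)
    · rw [min_eq_right hx] at h ⊢
      rcases le_total (-R) x with hx' | hx'
      · rw [max_eq_right hx']
      · rw [max_eq_left hx'] at h
        exact absurd h.1 (lt_irrefl _)

variable {H : Type*} [NormedAddCommGroup H] [InnerProductSpace ℝ H] {e : ℕ → H}

/-- The embedding of `H` into a compact product by coordinates. -/
def coords (e : ℕ → H) (z : H) (j : ℕ) : EReal := (⟪z, e j⟫ : ℝ)

lemma continuous_coords (e : ℕ → H) : Continuous (coords e) :=
  continuous_pi fun j => continuous_coe_real_ereal.comp (by fun_prop)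

lemma coords_injective [CompleteSpace H] (hON : Orthonormal ℝ e)
    (hTot : (Submodule.span ℝ (Set.range e)).topologicalClosure = ⊤) :
    Function.Injective (coords e) := by
  intro x y hxy
  have h : ∀ n, truncation e n x = truncation e n y := fun n => by
    simp only [truncation_apply]
    refine Finset.sum_congr rfl fun j _ => ?_
    rw [EReal.coe_injective (congrFun hxy j)]
  refine tendsto_nhds_unique (tendsto_truncation hON hTot x) ?_
  simpa only [h] using tendsto_truncation hON hTot y

/-- The extension to the compactification of `H` of the truncations of `H`, with coordinates
clamped to `[-R, R]`. -/
def clampTruncation (e : ℕ → H) (R : ℝ) (n : ℕ) (κ : ℕ → EReal) : H :=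
  ∑ j ∈ Finset.range n, clampReal R (κ j) • e j

lemma continuous_clampTruncation (e : ℕ → H) (R : ℝ) (n : ℕ) :
    Continuous (clampTruncation e R n) :=
  continuous_finsetSum _ fun j _ =>
    ((continuous_clampReal R).comp (continuous_apply j)).smul continuous_const

lemma clampTruncation_coords (hON : Orthonormal ℝ e) {R : ℝ} (hR : 0 < R) (n : ℕ) (z : H) :
    clampTruncation e R n (coords e z) = truncation e n z ∨
      R ≤ ‖clampTruncation e R n (coords e z)‖ ∧ R ≤ ‖truncation e n z‖ := by
  by_cases h : ∀ j ∈ Finset.range n, |⟪z, e j⟫| ≤ R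
  · left
    rw [clampTruncation, truncation_apply]
    refine Finset.sum_congr rfl fun j hj => ?_
    obtain ⟨h₁, h₂⟩ := abs_le.1 (h j hj)
    rw [coords, clampReal_coe, min_eq_right h₂, max_eq_right h₁]
  · right
    push Not at h
    obtain ⟨j, hj, hjR⟩ := h
    have key : ∀ a : ℕ → ℝ, R ≤ |a j| → R ≤ ‖∑ j ∈ Finset.range n, a j • e j‖ := fun a ha => by
      refine le_of_sq_le_sq ?_ (norm_nonneg _)
      rw [norm_sq_sum_smul hON]
      refine le_trans ?_ (Finset.single_le_sum (f := fun i => a i ^ 2)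
        (fun i _ => sq_nonneg _) hj)
      rw [← sq_abs (a j)]
      gcongr
    refine ⟨key _ ?_, ?_⟩
    · rw [coords, clampReal_coe]
      rcases lt_abs.1 hjR with h | h
      · rw [min_eq_left h.le, max_eq_right (by linarith)]
        exact le_abs_self R
      · rw [min_eq_right (by linarith), max_eq_left (by linarith), abs_neg]
        exact le_abs_self R
    · rw [truncation_apply]
      exact key _ hjR.le

lemma cutoff_mul_clampTruncation_coords (hON : Orthonormal ℝ e) {R : ℝ} (hR : 0 < R) (n : ℕ)
    (g : H → ℝ) (z : H) :
    cutoff R (clampTruncation e R n (coords e z)) * g (clampTruncation e R n (coords e z)) =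
      cutoff R (truncation e n z) * g (truncation e n z) := by
  rcases clampTruncation_coords hON hR n z with h | ⟨h₁, h₂⟩
  · rw [h]
  · rw [cutoff_eq_zero hR h₁, cutoff_eq_zero hR h₂, zero_mul, zero_mul]

lemma norm_clampTruncation_mono (hON : Orthonormal ℝ e) (R : ℝ) (κ : ℕ → EReal) :
    Monotone fun n => ‖clampTruncation e R n κ‖ := by
  intro m n hmn
  refine le_of_sq_le_sq ?_ (norm_nonneg _)
  simp only [clampTruncation, norm_sq_sum_smul hON]
  exact Finset.sum_le_sum_of_subset_of_nonneg (Finset.range_mono hmn) fun _ _ _ => sq_nonneg _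

lemma mem_range_coords [CompleteSpace H] (hON : Orthonormal ℝ e) {R : ℝ} {κ : ℕ → EReal}
    (h : ∀ n, ‖clampTruncation e R n κ‖ < R) : κ ∈ Set.range (coords e) := by
  set a : ℕ → ℝ := fun j => clampReal R (κ j) with ha
  have hR : 0 < R := (norm_nonneg _).trans_lt (h 0)
  have hsq : ∀ n, ∑ j ∈ Finset.range n, a j ^ 2 ≤ R ^ 2 := fun n => by
    rw [← norm_sq_sum_smul hON]
    exact pow_le_pow_left₀ (norm_nonneg _) (h n).le 2
  have hlt : ∀ j, |a j| < R := fun j => by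
    refine lt_of_le_of_lt ?_ (h (j + 1))
    refine le_of_sq_le_sq ?_ (norm_nonneg _)
    rw [clampTruncation, norm_sq_sum_smul hON, sq_abs]
    exact Finset.single_le_sum (f := fun i => a i ^ 2) (fun i _ => sq_nonneg _)
      (Finset.self_mem_range_succ j)
  have hsum : Summable fun j => a j • e j := by
    rw [summable_smul_iff hON]
    exact summable_of_sum_range_le (fun _ => sq_nonneg _) hsq
  refine ⟨∑' j, a j • e j, funext fun i => ?_⟩
  have h₁ : Tendsto (fun n => ⟪∑ j ∈ Finset.range n, a j • e j, e i⟫) atTop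
      (nhds ⟪∑' j, a j • e j, e i⟫) := hsum.hasSum.tendsto_sum_nat.inner tendsto_const_nhds
  have h₂ : Tendsto (fun n => ⟪∑ j ∈ Finset.range n, a j • e j, e i⟫) atTop (nhds (a i)) := by
    refine tendsto_const_nhds.congr' ?_
    filter_upwards [eventually_gt_atTop i] with n hn
    rw [inner_sum_smul hON, if_pos hn]
  rw [coords, tendsto_nhds_unique h₁ h₂]
  exact (eq_coe_clampReal (hlt i)).symm

end Compactification

section Duality

variable {H : Type*} [NormedAddCommGroup H] [InnerProductSpace ℝ H] [MeasurableSpace H]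
  [BorelSpace H] {e : ℕ → H} {α c : ℕ → ℝ}
  {μ : Measure H} {ρ : H → ℝ} {g : H → ℝ} {Dg : H → H}

/-- Pairs of a continuous function on the compactification restricting to
`(z, b) ↦ ∑ j, g_j(z) c_j b_j` on `H`, and the value of the divergence functional at
`G = ∑ j, g_j e_j`. -/
def divergenceRelation (e : ℕ → H) (α c : ℕ → ℝ) (hρpos : ∀ z, 0 ≤ ρ z) (hρ : Integrable ρ μ)
    (hρn : Integrable (fun z => ‖z‖ * ρ z) μ) :
    Submodule ℝ (C((ℕ → EReal) × sqBall, ℝ) × ℝ) where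
  carrier := {p | ∃ (g : ℕ → H → ℝ) (Dg : ℕ → H → H), (∀ j, IsCb1 (g j) (Dg j)) ∧
    ∀ᶠ N in atTop, (∀ z b, p.1 (coords e z, b) = ∑ j ∈ Finset.range N, g j z * c j * b.1 j) ∧
      p.2 = ∑ j ∈ Finset.range N, ibp μ ρ (g j) (Dg j) (e j) (α j • e j)}
  zero_mem' := ⟨fun _ => 0, fun _ => 0, fun _ => IsCb1.zero, Eventually.of_forall fun N => by
    simp [ibp]⟩
  add_mem' := by
    rintro p q ⟨g, Dg, hg, hp⟩ ⟨g', Dg', hg', hq⟩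
    refine ⟨g + g', Dg + Dg', fun j => (hg j).add (hg' j), ?_⟩
    filter_upwards [hp, hq] with N hp hq
    refine ⟨fun z b => ?_, ?_⟩
    · rw [Prod.fst_add, ContinuousMap.add_apply, hp.1, hq.1, ← Finset.sum_add_distrib]
      exact Finset.sum_congr rfl fun j _ => by simp only [Pi.add_apply]; ring
    · rw [Prod.snd_add, hp.2, hq.2, ← Finset.sum_add_distrib]
      exact Finset.sum_congr rfl fun j _ => (ibp_add hρpos hρ hρn (hg j) (hg' j) _ _).symm
  smul_mem' := by
    rintro a p ⟨g, Dg, hg, hp⟩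
    refine ⟨a • g, a • Dg, fun j => (hg j).const_smul a, ?_⟩
    filter_upwards [hp] with N hp
    refine ⟨fun z b => ?_, ?_⟩
    · rw [Prod.smul_fst, ContinuousMap.smul_apply, hp.1, smul_eq_mul, Finset.mul_sum]
      exact Finset.sum_congr rfl fun j _ => by simp only [Pi.smul_apply, smul_eq_mul]; ring
    · rw [Prod.smul_snd, hp.2, smul_eq_mul, Finset.mul_sum]
      exact Finset.sum_congr rfl fun j _ => (ibp_const_smul a _ _).symm

/-- The function `(χ_R g) ∘ P_n`. -/
def cutoffTruncation (e : ℕ → H) (R : ℝ) (n : ℕ) (g : H → ℝ) (z : H) : ℝ :=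
  cutoff R (truncation e n z) * g (truncation e n z)

/-- The gradient of `(χ_R g) ∘ P_n`. -/
def gradCutoffTruncation (e : ℕ → H) (R : ℝ) (n : ℕ) (g : H → ℝ) (Dg : H → H) (z : H) : H :=
  truncation e n (gradCutoffMul R g Dg (truncation e n z))

omit [MeasurableSpace H] [BorelSpace H] in
lemma IsCb1.cutoffTruncation (hg : IsCb1 g Dg) {R : ℝ} (hR : 0 < R) (n : ℕ) :
    IsCb1 (cutoffTruncation e R n g) (gradCutoffTruncation e R n g Dg) :=
  (hg.cutoff_mul hR).comp_symmetric (truncation_symm e n)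

lemma mem_divergenceRelation (hON : Orthonormal ℝ e) (hρpos : ∀ z, 0 ≤ ρ z) (hρ : Integrable ρ μ)
    (hρn : Integrable (fun z => ‖z‖ * ρ z) μ) (hg : IsCb1 g Dg) {R : ℝ} (hR : 0 < R) (n i : ℕ)
    {F : C((ℕ → EReal) × sqBall, ℝ)}
    (hF : ∀ p, F p = cutoff R (clampTruncation e R n p.1) * g (clampTruncation e R n p.1) *
      c i * p.2.1 i) :
    (F, ibp μ ρ (cutoffTruncation e R n g) (gradCutoffTruncation e R n g Dg) (e i) (α i • e i)) ∈
      divergenceRelation e α c hρpos hρ hρn := by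
  refine ⟨fun j => if j = i then cutoffTruncation e R n g else 0,
    fun j => if j = i then gradCutoffTruncation e R n g Dg else 0, fun j => ?_, ?_⟩
  · by_cases hj : j = i
    · simpa only [if_pos hj] using hg.cutoffTruncation hR n
    · simpa only [if_neg hj] using IsCb1.zero
  · filter_upwards [eventually_gt_atTop i] with N hN
    refine ⟨fun z b => ?_, ?_⟩
    · rw [Finset.sum_eq_single_of_mem i (Finset.mem_range.2 hN)
        fun j _ hj => by simp [hj], if_pos rfl, hF, cutoff_mul_clampTruncation_coords hON hR]
      rfl
    · rw [Finset.sum_eq_single_of_mem i (Finset.mem_range.2 hN)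
        fun j _ hj => by simp [hj, ibp], if_pos rfl, if_pos rfl]

omit [MeasurableSpace H] [BorelSpace H] in
lemma sq_mul_sq_inner_basis_sum (hON : Orthonormal ℝ e) (N : ℕ) (a : ℕ → ℝ) (j : ℕ) :
    c j ^ 2 * ⟪∑ i : Fin N, a i • e i, e j⟫ ^ 2 = if j < N then (c j * a j) ^ 2 else 0 := by
  rw [Fin.sum_univ_eq_sum_range fun i => a i • e i, inner_sum_smul hON]
  split_ifs
  · ring
  · simp

omit [MeasurableSpace H] [BorelSpace H] in
lemma hasSum_normH1_basis_sum (hON : Orthonormal ℝ e) (N : ℕ) (a : ℕ → ℝ) :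
    HasSum (fun j => c j ^ 2 * ⟪∑ i : Fin N, a i • e i, e j⟫ ^ 2)
      (∑ j ∈ Finset.range N, (c j * a j) ^ 2) := by
  simp only [sq_mul_sq_inner_basis_sum hON]
  have : HasSum (fun j => if j < N then (c j * a j) ^ 2 else 0)
      (∑ j ∈ Finset.range N, if j < N then (c j * a j) ^ 2 else 0) :=
    hasSum_sum_of_ne_finset_zero fun j hj => if_neg (by simpa using hj)
  convert this using 1
  exact Finset.sum_congr rfl fun j hj => by rw [if_pos (Finset.mem_range.1 hj)]

lemma sum_ibp_mem_BVset (hON : Orthonormal ℝ e) (hρpos : ∀ z, 0 ≤ ρ z) (hρ : Integrable ρ μ)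
    (hρn : Integrable (fun z => ‖z‖ * ρ z) μ) {g : ℕ → H → ℝ} {Dg : ℕ → H → H}
    (hg : ∀ j, IsCb1 (g j) (Dg j)) {N : ℕ}
    (h : ∀ z, ∑ j ∈ Finset.range N, (c j * g j z) ^ 2 ≤ 1) :
    ∑ j ∈ Finset.range N, ibp μ ρ (g j) (Dg j) (e j) (α j • e j) ∈ BVset c e α μ ρ := by
  have hsingle : ∀ (w : ℕ → ℝ) (i : ℕ), Summable fun j => w j ^ 2 * ⟪e i, e j⟫ ^ 2 := fun w i =>
    summable_of_ne_finset_zero (s := {i}) fun j hj => by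
      rw [hON.2 (fun h => hj (by simp [h])), zero_pow two_ne_zero, mul_zero]
  refine ⟨N, fun i => g i, fun i => Dg i, fun i => e i, fun i => hg i, fun i => hsingle _ _,
    fun i => hsingle _ _, fun z => ⟨(hasSum_normH1_basis_sum hON N fun i => g i z).summable, ?_⟩, ?_⟩
  · exact (hasSum_normH1_basis_sum hON N fun i => g i z).tsum_eq.trans_le (h z)
  · rw [integral_Dstar_mul hρpos hρ hρn fun i => hg i]
    simp only [Aop_basis hON]
    rw [Fin.sum_univ_eq_sum_range fun j => ibp μ ρ (g j) (Dg j) (e j) (α j • e j)]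

omit [BorelSpace H] in
lemma zero_mem_BVset : (0 : ℝ) ∈ BVset c e α μ ρ :=
  ⟨0, Fin.elim0, Fin.elim0, Fin.elim0, fun i => i.elim0, fun i => i.elim0, fun i => i.elim0,
    fun z => by simp [memH1, normH1sq], by simp [Dstar]⟩

lemma sum_sq_le_of_forall_sum_mul_le {N : ℕ} {x : ℕ → ℝ} {s : ℝ}
    (h : ∀ b ∈ sqBall, ∑ j ∈ Finset.range N, x j * b j ≤ s) :
    ∑ j ∈ Finset.range N, x j ^ 2 ≤ s ^ 2 := by
  have hs : 0 ≤ s := by simpa using h 0 fun N => by simp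
  set T := ∑ j ∈ Finset.range N, x j ^ 2 with hT
  have hT0 : 0 ≤ T := Finset.sum_nonneg fun j _ => sq_nonneg (x j)
  rcases hT0.eq_or_lt with h0 | h0
  · rw [← h0]; positivity
  have hq : 0 < √T := Real.sqrt_pos.2 h0
  have hb : (fun j => if j < N then x j / √T else 0) ∈ sqBall := fun K => by
    have : ∀ j, (if j < N then x j / √T else 0) ^ 2 = if j < N then x j ^ 2 / T else 0 := fun j => by
      split_ifs
      · rw [div_pow, Real.sq_sqrt h0.le]
      · simp
    simp only [this, ← Finset.sum_filter]
    calc _ ≤ ∑ j ∈ Finset.range N, x j ^ 2 / T :=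
          Finset.sum_le_sum_of_subset_of_nonneg (fun j => by simp) fun _ _ _ => by positivity
      _ = 1 := by rw [← Finset.sum_div, div_self h0.ne']
  have h₁ := h _ hb
  have h₂ : ∑ j ∈ Finset.range N, x j * (if j < N then x j / √T else 0) = √T := by
    rw [Finset.sum_congr rfl fun j hj => by rw [if_pos (Finset.mem_range.1 hj)]]
    simp only [← mul_div_assoc, ← sq, ← Finset.sum_div]
    exact Real.div_sqrt
  rw [h₂] at h₁
  rw [← Real.sq_sqrt h0.le]
  gcongr

lemma le_mul_of_mem_divergenceRelation (hON : Orthonormal ℝ e) (hρpos : ∀ z, 0 ≤ ρ z)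
    (hρ : Integrable ρ μ) (hρn : Integrable (fun z => ‖z‖ * ρ z) μ)
    (hBV : BddAbove (BVset c e α μ ρ)) {F : C((ℕ → EReal) × sqBall, ℝ)} {r s : ℝ}
    (hFr : (F, r) ∈ divergenceRelation e α c hρpos hρ hρn) (hs : ∀ x, F x ≤ s) :
    r ≤ sSup (BVset c e α μ ρ) * s := by
  obtain ⟨g, Dg, hg, hN⟩ := hFr
  obtain ⟨N, hF, hr⟩ := hN.exists
  simp only at hF hr
  have hs0 : 0 ≤ s := by
    have := hs (coords e 0, ⟨0, fun N => by simp⟩)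
    rw [hF] at this
    simpa using this
  have hsq : ∀ z, ∑ j ∈ Finset.range N, (c j * g j z) ^ 2 ≤ s ^ 2 := fun z =>
    sum_sq_le_of_forall_sum_mul_le fun b hb => by
      have := hs (coords e z, ⟨b, hb⟩)
      rw [hF] at this
      simpa only [mul_comm (c _)] using this
  have key : ∀ t, s < t → r ≤ sSup (BVset c e α μ ρ) * t := fun t ht => by
    have ht0 : 0 < t := hs0.trans_lt ht
    have := le_csSup hBV (sum_ibp_mem_BVset (α := α) hON hρpos hρ hρn (N := N)
      (fun j => (hg j).const_smul t⁻¹) fun z => by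
        calc _ = (∑ j ∈ Finset.range N, (c j * g j z) ^ 2) / t ^ 2 := by
              rw [Finset.sum_div]
              refine Finset.sum_congr rfl fun j _ => ?_
              simp only [Pi.smul_apply, smul_eq_mul]
              field_simp
          _ ≤ 1 := by
              rw [div_le_one (by positivity)]
              exact (hsq z).trans (by gcongr))
    simp only [ibp_const_smul, ← Finset.mul_sum, ← hr] at this
    rwa [inv_mul_le_iff₀ ht0, mul_comm t] at this
  refine ge_of_tendsto (x := nhdsWithin s (Set.Ioi s)) ?_ (eventually_nhdsWithin_of_forall key)
  exact ((continuous_const.mul continuous_id).tendsto s).mono_left nhdsWithin_le_nhds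

/-- A measure on the compactification represents the divergence functional if it does so on
cylindrical functions with bounded support. -/
def RepresentsDivergence (e : ℕ → H) (α c : ℕ → ℝ) (μ : Measure H) (ρ : H → ℝ)
    (M : Measure ((ℕ → EReal) × sqBall)) : Prop :=
  ∀ (g : H → ℝ) (Dg : H → H), IsCb1 g Dg → ∀ R : ℝ, 0 < R → ∀ n i : ℕ,
    ∫ p, cutoff R (clampTruncation e R n p.1) * g (clampTruncation e R n p.1) * c i * p.2.1 i ∂M =
      ibp μ ρ (cutoffTruncation e R n g) (gradCutoffTruncation e R n g Dg) (e i) (α i • e i)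

omit [MeasurableSpace H] [BorelSpace H] in
lemma continuous_cutoff_clampTruncation (hg : IsCb1 g Dg) {R : ℝ} (hR : 0 < R) (n i : ℕ) :
    Continuous fun p : (ℕ → EReal) × sqBall =>
      cutoff R (clampTruncation e R n p.1) * g (clampTruncation e R n p.1) * c i * p.2.1 i :=
  (((hg.cutoff_mul hR).continuous.comp ((continuous_clampTruncation e R n).comp
    continuous_fst)).mul continuous_const).mul
      ((continuous_apply i).comp (continuous_subtype_val.comp continuous_snd))

/-- The representing measure on the compactification. -/
theorem exists_representsDivergence (hON : Orthonormal ℝ e) (hρpos : ∀ z, 0 ≤ ρ z)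
    (hρ : Integrable ρ μ) (hρn : Integrable (fun z => ‖z‖ * ρ z) μ)
    (hBV : BddAbove (BVset c e α μ ρ)) :
    ∃ M : Measure ((ℕ → EReal) × sqBall), IsFiniteMeasure M ∧
      M.real Set.univ = sSup (BVset c e α μ ρ) ∧ RepresentsDivergence e α c μ ρ M := by
  obtain ⟨M, hM, hMV, hMS⟩ := exists_measure_of_le_mul_sup (le_csSup hBV zero_mem_BVset)
    (divergenceRelation e α c hρpos hρ hρn)
    fun F r hFr s hs => le_mul_of_mem_divergenceRelation hON hρpos hρ hρn hBV hFr hs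
  exact ⟨M, hM, hMV, fun g Dg hg R hR n i => hMS
    ⟨_, continuous_cutoff_clampTruncation hg hR n i⟩ _
    (mem_divergenceRelation hON hρpos hρ hρn hg hR n i fun p => rfl)⟩

end Duality

section Tightness

variable {H : Type*} [NormedAddCommGroup H] [InnerProductSpace ℝ H]
  [MeasurableSpace H] [BorelSpace H] {e : ℕ → H} {α c : ℕ → ℝ} {μ : Measure H} {ρ : H → ℝ}
  {M : Measure ((ℕ → EReal) × sqBall)} [IsFiniteMeasure M]

omit [MeasurableSpace H] [BorelSpace H] in
lemma integrable_cutoff_clampTruncation {g : H → ℝ} {Dg : H → H} (hg : IsCb1 g Dg) {R : ℝ}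
    (hR : 0 < R) (n i : ℕ) : Integrable (fun p : (ℕ → EReal) × sqBall =>
      cutoff R (clampTruncation e R n p.1) * g (clampTruncation e R n p.1) * c i * p.2.1 i) M :=
  (continuous_cutoff_clampTruncation hg hR n i).integrable_of_hasCompactSupport
    (HasCompactSupport.of_compactSpace _)

omit [MeasurableSpace H] [BorelSpace H] in
lemma sum_sq_le_one_of_normH1sq_le {x : H} (hx : memH1 c e x) (hx1 : normH1sq c e x ≤ 1) (N : ℕ) :
    ∑ j ∈ Finset.range N, (c j * ⟪x, e j⟫) ^ 2 ≤ 1 := by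
  simp only [mul_pow]
  exact (Summable.sum_le_tsum _ (fun _ _ => by positivity) hx).trans hx1

omit [MeasurableSpace H] [BorelSpace H] in
lemma measurableSet_norm_clampTruncation_lt (R : ℝ) (n : ℕ) :
    MeasurableSet {p : (ℕ → EReal) × sqBall | ‖clampTruncation e R n p.1‖ < R} :=
  (isOpen_lt ((continuous_clampTruncation e R n).comp continuous_fst).norm
    continuous_const).measurableSet

variable {k : ℕ} {g : Fin k → H → ℝ} {Dg : Fin k → H → H} {l : Fin k → H}

omit [BorelSpace H] in
lemma sum_sum_ibp_cutoffTruncation_le (hM : RepresentsDivergence e α c μ ρ M)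
    (hg : ∀ i, IsCb1 (g i) (Dg i))
    (hG : ∀ z, memH1 c e (∑ i, g i z • l i) ∧ normH1sq c e (∑ i, g i z • l i) ≤ 1)
    {R : ℝ} (hR : 0 < R) (n N : ℕ) :
    ∑ i, ∑ j ∈ Finset.range N, ⟪l i, e j⟫ * ibp μ ρ (cutoffTruncation e R n (g i))
      (gradCutoffTruncation e R n (g i) (Dg i)) (e j) (α j • e j) ≤
      M.real {p | ‖clampTruncation e R n p.1‖ < R} := by
  have hint : ∀ i j, Integrable (fun p : (ℕ → EReal) × sqBall => ⟪l i, e j⟫ *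
      (cutoff R (clampTruncation e R n p.1) * g i (clampTruncation e R n p.1) * c j * p.2.1 j)) M :=
    fun i j => (integrable_cutoff_clampTruncation (hg i) hR n j).const_mul _
  have hA := measurableSet_norm_clampTruncation_lt (e := e) R n
  simp only [← hM _ _ (hg _) R hR n, ← integral_const_mul]
  rw [Finset.sum_congr rfl fun i _ => (integral_finsetSum _ fun j _ => hint i j).symm,
    ← integral_finsetSum _ fun i _ => integrable_finsetSum _ fun j _ => hint i j,
    ← integral_indicator_one hA]
  refine integral_mono (integrable_finsetSum _ fun i _ => integrable_finsetSum _ fun j _ =>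
    hint i j) ((integrable_const (1 : ℝ)).indicator hA) fun p => ?_
  set z := clampTruncation e R n p.1 with hz
  have hsum : ∑ i, ∑ j ∈ Finset.range N, ⟪l i, e j⟫ * (cutoff R z * g i z * c j * p.2.1 j) =
      cutoff R z * ∑ j ∈ Finset.range N, c j * ⟪∑ i, g i z • l i, e j⟫ * p.2.1 j := by
    rw [Finset.sum_comm, Finset.mul_sum]
    refine Finset.sum_congr rfl fun j _ => ?_
    simp only [sum_inner, real_inner_smul_left, Finset.mul_sum, Finset.sum_mul]
    exact Finset.sum_congr rfl fun i _ => by ring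
  simp only [hsum]
  by_cases h : ‖z‖ < R
  · rw [Set.indicator_of_mem (by exact h)]
    have h₁ : ∑ j ∈ Finset.range N, c j * ⟪∑ i, g i z • l i, e j⟫ * p.2.1 j ≤ 1 :=
      sum_mul_le_one_of_mem_sqBall p.2.2 (sum_sq_le_one_of_normH1sq_le (hG z).1 (hG z).2 N)
    calc _ ≤ cutoff R z * 1 := mul_le_mul_of_nonneg_left h₁ (cutoff_nonneg _ _)
      _ ≤ 1 := by rw [mul_one]; exact cutoff_le_one _ _
  · rw [Set.indicator_of_notMem (by exact h), cutoff_eq_zero hR (not_lt.1 h), zero_mul]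

variable [CompleteSpace H]

lemma sum_ibp_le_measureReal_range (hON : Orthonormal ℝ e)
    (hTot : (Submodule.span ℝ (Set.range e)).topologicalClosure = ⊤)
    (hρpos : ∀ z, 0 ≤ ρ z) (hρ : Integrable ρ μ) (hρn : Integrable (fun z => ‖z‖ * ρ z) μ)
    (hM : RepresentsDivergence e α c μ ρ M)
    (hg : ∀ i, IsCb1 (g i) (Dg i)) (hl : ∀ i, memDA e α (l i))
    (hG : ∀ z, memH1 c e (∑ i, g i z • l i) ∧ normH1sq c e (∑ i, g i z • l i) ≤ 1) :
    ∑ i, ibp μ ρ (g i) (Dg i) (l i) (Aop e α (l i)) ≤ M.real (Set.range (coords e) ×ˢ Set.univ) := by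
  have h₁ : ∀ (R : ℝ) (_ : 0 < R) (n : ℕ),
      ∑ i, ibp μ ρ (cutoffTruncation e R n (g i)) (gradCutoffTruncation e R n (g i) (Dg i)) (l i)
        (Aop e α (l i)) ≤ M.real {p | ‖clampTruncation e R n p.1‖ < R} := fun R hR n =>
    le_of_tendsto' (tendsto_finsetSum _ fun i _ => tendsto_sum_mul_ibp_basis hON hTot hρpos hρ hρn
      ((hg i).cutoffTruncation hR n) (hl i)) fun N =>
      sum_sum_ibp_cutoffTruncation_le hM hg hG hR n N
  have h₂ : ∀ (R : ℝ) (_ : 0 < R), ∑ i, ibp μ ρ (fun z => cutoff R z * g i z)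
      (gradCutoffMul R (g i) (Dg i)) (l i) (Aop e α (l i)) ≤
      M.real (Set.range (coords e) ×ˢ Set.univ) := fun R hR => by
    have hanti : Antitone fun n => {p : (ℕ → EReal) × sqBall | ‖clampTruncation e R n p.1‖ < R} :=
      fun m n hmn p hp => (norm_clampTruncation_mono hON R p.1 hmn).trans_lt hp
    have hlim := tendsto_measure_iInter_atTop (μ := M)
      (fun n => (measurableSet_norm_clampTruncation_lt (e := e) R n).nullMeasurableSet) hanti
      ⟨0, measure_ne_top M _⟩
    refine (le_of_tendsto_of_tendsto' (tendsto_finsetSum _ fun i _ => tendsto_ibp_truncation hON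
      hTot hρpos hρ hρn ((hg i).cutoff_mul hR) (l i) (Aop e α (l i)))
      ((ENNReal.tendsto_toReal (measure_ne_top M _)).comp hlim) (h₁ R hR)).trans ?_
    refine measureReal_mono (fun p hp => ⟨?_, trivial⟩)
    exact mem_range_coords hON (R := R) fun n => Set.mem_iInter.1 hp n
  exact le_of_tendsto' (tendsto_finsetSum _ fun i _ => tendsto_ibp_cutoff hρpos hρ hρn (hg i) (l i)
    (Aop e α (l i))) fun n => h₂ _ (by positivity)

lemma measureReal_range_coords (hON : Orthonormal ℝ e)
    (hTot : (Submodule.span ℝ (Set.range e)).topologicalClosure = ⊤)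
    (hρpos : ∀ z, 0 ≤ ρ z) (hρ : Integrable ρ μ) (hρn : Integrable (fun z => ‖z‖ * ρ z) μ)
    (hM : RepresentsDivergence e α c μ ρ M) (hMV : M.real Set.univ = sSup (BVset c e α μ ρ)) :
    M.real (Set.range (coords e) ×ˢ Set.univ) = M.real Set.univ := by
  refine le_antisymm (measureReal_mono (Set.subset_univ _)) ?_
  rw [hMV]
  refine csSup_le ⟨0, zero_mem_BVset⟩ ?_
  rintro r ⟨k, g, Dg, l, hg, hl, -, hG, rfl⟩
  rw [integral_Dstar_mul hρpos hρ hρn hg]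
  exact sum_ibp_le_measureReal_range hON hTot hρpos hρ hρn hM hg hl hG

lemma measurableEmbedding_coords [SecondCountableTopology H] (hON : Orthonormal ℝ e)
    (hTot : (Submodule.span ℝ (Set.range e)).topologicalClosure = ⊤) :
    MeasurableEmbedding (Prod.map (coords e) (id : sqBall → sqBall)) :=
  ((continuous_coords e).prodMap continuous_id).measurableEmbedding
    ((coords_injective hON hTot).prodMap Function.injective_id)

/-- The representing measure is carried by `H`. -/
theorem exists_map_coords_eq [SecondCountableTopology H] (hON : Orthonormal ℝ e)
    (hTot : (Submodule.span ℝ (Set.range e)).topologicalClosure = ⊤)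
    (hρpos : ∀ z, 0 ≤ ρ z) (hρ : Integrable ρ μ) (hρn : Integrable (fun z => ‖z‖ * ρ z) μ)
    (hM : RepresentsDivergence e α c μ ρ M) (hMV : M.real Set.univ = sSup (BVset c e α μ ρ)) :
    ∃ M' : Measure (H × sqBall), IsFiniteMeasure M' ∧ M'.map (Prod.map (coords e) id) = M := by
  have hΦ := measurableEmbedding_coords hON hTot
  have hmap : (M.comap (Prod.map (coords e) id)).map (Prod.map (coords e) id) = M := by
    rw [hΦ.map_comap]
    refine Measure.restrict_eq_self_of_ae_mem ((ae_iff_measure_eq (p := fun x => x ∈ Set.range _)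
      hΦ.measurableSet_range.nullMeasurableSet).2 ?_)
    have hr : {a | a ∈ Set.range (Prod.map (coords e) (id : sqBall → sqBall))} =
        Set.range (coords e) ×ˢ Set.univ := by
      rw [Set.ofPred_mem_eq, Set.range_prodMap, Set.range_id]
    rw [hr, ← measureReal_eq_measureReal_iff]
    exact measureReal_range_coords hON hTot hρpos hρ hρn hM hMV
  refine ⟨_, ⟨?_⟩, hmap⟩
  have := measure_lt_top M Set.univ
  rwa [← hmap, hΦ.map_apply, Set.preimage_univ] at this

end Tightness

section Disintegration

lemma summable_sq_of_mem_sqBall {b : ℕ → ℝ} (hb : b ∈ sqBall) : Summable fun j => b j ^ 2 :=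
  summable_of_sum_range_le (fun _ => sq_nonneg _) hb

lemma tsum_sq_le_one_of_mem_sqBall {b : ℕ → ℝ} (hb : b ∈ sqBall) : ∑' j, b j ^ 2 ≤ 1 :=
  (summable_sq_of_mem_sqBall hb).tsum_le_of_sum_range_le hb

lemma abs_mul_le_half_add_sq (x y : ℝ) : |x * y| ≤ (x ^ 2 + y ^ 2) / 2 := by
  rw [abs_le]
  constructor <;> nlinarith [sq_nonneg (x + y), sq_nonneg (x - y)]

lemma summable_mul_of_sq {x y : ℕ → ℝ} (hx : Summable fun j => x j ^ 2)
    (hy : Summable fun j => y j ^ 2) : Summable fun j => x j * y j :=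
  ((hx.add hy).div_const 2).of_norm_bounded fun _ => abs_mul_le_half_add_sq _ _

lemma tsum_mul_le_half_add_sq {x y : ℕ → ℝ} (hx : Summable fun j => x j ^ 2)
    (hy : Summable fun j => y j ^ 2) :
    ∑' j, x j * y j ≤ (∑' j, x j ^ 2 + ∑' j, y j ^ 2) / 2 := by
  rw [← hx.tsum_add hy, ← tsum_div_const]
  exact (summable_mul_of_sq hx hy).tsum_le_tsum
    (fun j => (le_abs_self _).trans (abs_mul_le_half_add_sq _ _)) ((hx.add hy).div_const 2)

lemma abs_sum_mul_le_of_mem_sqBall {x b : ℕ → ℝ} (hx : Summable fun j => x j ^ 2)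
    (hb : b ∈ sqBall) (N : ℕ) :
    |∑ j ∈ Finset.range N, x j * b j| ≤ (∑' j, x j ^ 2 + 1) / 2 := by
  calc _ ≤ ∑ j ∈ Finset.range N, (x j ^ 2 + b j ^ 2) / 2 :=
        (Finset.abs_sum_le_sum_abs _ _).trans
          (Finset.sum_le_sum fun j _ => abs_mul_le_half_add_sq _ _)
    _ ≤ _ := by
        rw [← Finset.sum_div, Finset.sum_add_distrib]
        have := hx.sum_le_tsum (Finset.range N) fun _ _ => sq_nonneg _
        linarith [hb N]

lemma abs_tsum_mul_le_of_mem_sqBall {x b : ℕ → ℝ} (hx : Summable fun j => x j ^ 2)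
    (hb : b ∈ sqBall) : |∑' j, x j * b j| ≤ (∑' j, x j ^ 2 + 1) / 2 :=
  le_of_tendsto' (summable_mul_of_sq hx (summable_sq_of_mem_sqBall hb)).tendsto_sum_tsum_nat.abs
    fun N => abs_sum_mul_le_of_mem_sqBall hx hb N

lemma integrable_coord (κ : Measure sqBall) [IsFiniteMeasure κ] (j : ℕ) :
    Integrable (fun b : sqBall => b.1 j) κ :=
  ((continuous_apply j).comp continuous_subtype_val).integrable_of_hasCompactSupport
    (HasCompactSupport.of_compactSpace _)

/-- The barycenter of a probability measure on the ball of `ℓ²` lies in the ball. -/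
lemma integral_coord_mem_sqBall (κ : Measure sqBall) [IsProbabilityMeasure κ] :
    (fun j => ∫ b, b.1 j ∂κ) ∈ sqBall := by
  intro N
  set y : ℕ → ℝ := fun j => ∫ b, b.1 j ∂κ with hy
  have hint : ∀ j, Integrable (fun b : sqBall => y j * b.1 j) κ := fun j =>
    (integrable_coord κ j).const_mul _
  have h : ∑ j ∈ Finset.range N, y j ^ 2 ≤ (∑ j ∈ Finset.range N, y j ^ 2 + 1) / 2 := by
    calc _ = ∫ b, ∑ j ∈ Finset.range N, y j * b.1 j ∂κ := by
          rw [integral_finsetSum _ fun j _ => hint j]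
          simp only [integral_const_mul, sq, hy]
      _ ≤ ∫ _, (∑ j ∈ Finset.range N, y j ^ 2 + 1) / 2 ∂κ := by
          refine integral_mono (integrable_finsetSum _ fun j _ => hint j) (integrable_const _)
            fun b => ?_
          calc _ ≤ ∑ j ∈ Finset.range N, (y j ^ 2 + b.1 j ^ 2) / 2 :=
                Finset.sum_le_sum fun j _ =>
                  (le_abs_self _).trans (abs_mul_le_half_add_sq _ _)
            _ ≤ _ := by
                rw [← Finset.sum_div, Finset.sum_add_distrib]
                linarith [b.2 N]
      _ = _ := by simp
  linarith

variable {H : Type*} [NormedAddCommGroup H] [InnerProductSpace ℝ H]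
  [MeasurableSpace H] [BorelSpace H] [CompleteSpace H] [SecondCountableTopology H]
  {e : ℕ → H} {α c : ℕ → ℝ} {μ : Measure H} {ρ : H → ℝ}

omit [InnerProductSpace ℝ H] [CompleteSpace H] [SecondCountableTopology H] in
lemma tendsto_integral_mul_coord {M : Measure (H × sqBall)} [IsFiniteMeasure M]
    {hn : ℕ → H → ℝ} {h : H → ℝ} {C : ℝ} (hcont : ∀ n, Continuous (hn n))
    (hC : ∀ n z, |hn n z| ≤ C) (hlim : ∀ z, Tendsto (fun n => hn n z) atTop (nhds (h z)))
    (a : ℝ) (i : ℕ) :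
    Tendsto (fun n => ∫ p, hn n p.1 * a * p.2.1 i ∂M) atTop (nhds (∫ p, h p.1 * a * p.2.1 i ∂M)) := by
  refine tendsto_integral_of_dominated_convergence (fun _ => C * |a|) (fun n => ?_)
    (integrable_const _) (fun n => ae_of_all _ fun p => ?_) (ae_of_all _ fun p => ?_)
  · exact ((((hcont n).comp continuous_fst).mul continuous_const).mul ((continuous_apply i).comp
      (continuous_subtype_val.comp continuous_snd))).aestronglyMeasurable
  · have hC0 : 0 ≤ C := (abs_nonneg _).trans (hC n p.1)
    rw [Real.norm_eq_abs, abs_mul, abs_mul]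
    calc _ ≤ C * |a| * 1 := by
          gcongr
          exacts [hC n p.1, abs_le_one_of_mem_sqBall p.2.2 i]
      _ = _ := mul_one _
  · exact ((hlim p.1).mul_const a).mul_const _

lemma ibp_basis_eq_integral_prod (hON : Orthonormal ℝ e)
    (hTot : (Submodule.span ℝ (Set.range e)).topologicalClosure = ⊤)
    (hρpos : ∀ z, 0 ≤ ρ z) (hρ : Integrable ρ μ) (hρn : Integrable (fun z => ‖z‖ * ρ z) μ)
    {M : Measure (H × sqBall)} [IsFiniteMeasure M]
    (hM : RepresentsDivergence e α c μ ρ (M.map (Prod.map (coords e) id)))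
    {g : H → ℝ} {Dg : H → H} (hg : IsCb1 g Dg) (i : ℕ) :
    ibp μ ρ g Dg (e i) (α i • e i) = ∫ p, g p.1 * c i * p.2.1 i ∂M := by
  have hgc := hg.continuous
  obtain ⟨-, -, ⟨C, hC⟩, -⟩ := id hg
  have hCR : ∀ R z, |cutoff R z * g z| ≤ C := fun R z => by
    rw [abs_mul, abs_of_nonneg (cutoff_nonneg _ _)]
    exact (mul_le_of_le_one_left (abs_nonneg _) (cutoff_le_one _ _)).trans (hC z)
  have h₀ : ∀ (R : ℝ) (_ : 0 < R) (n : ℕ),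
      ∫ p, cutoffTruncation e R n g p.1 * c i * p.2.1 i ∂M =
      ibp μ ρ (cutoffTruncation e R n g) (gradCutoffTruncation e R n g Dg) (e i) (α i • e i) :=
    fun R hR n => by
      rw [← hM g Dg hg R hR n i, (measurableEmbedding_coords hON hTot).integral_map]
      simp only [Prod.map_fst, Prod.map_snd, id, cutoff_mul_clampTruncation_coords hON hR]
      rfl
  have h₁ : ∀ (R : ℝ) (_ : 0 < R), ∫ p, (cutoff R p.1 * g p.1) * c i * p.2.1 i ∂M =
      ibp μ ρ (fun z => cutoff R z * g z) (gradCutoffMul R g Dg) (e i) (α i • e i) :=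
    fun R hR => by
      have hc := (hg.cutoff_mul hR).continuous
      refine tendsto_nhds_unique (tendsto_integral_mul_coord (hn := fun n => cutoffTruncation e R n g)
        (h := fun z => cutoff R z * g z) (C := C)
        (fun n => (hg.cutoffTruncation hR n).continuous) (fun n z => hCR R _)
        (fun z => (hc.tendsto z).comp (tendsto_truncation hON hTot z)) (c i) i) ?_
      simp only [h₀ R hR]
      exact tendsto_ibp_truncation hON hTot hρpos hρ hρn (hg.cutoff_mul hR) _ _
  refine tendsto_nhds_unique (tendsto_ibp_cutoff hρpos hρ hρn hg _ _) ?_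
  have h₂ := tendsto_integral_mul_coord (M := M) (hn := fun n z => cutoff ((n : ℝ) + 1) z * g z)
    (h := g) (C := C) (fun n => (hg.cutoff_mul (by positivity)).continuous) (fun n z => hCR _ z)
    (fun z => by simpa using (tendsto_cutoff z).mul_const (g z)) (c i) i
  exact h₂.congr fun n => h₁ _ (by positivity)

/-- Disintegration of the representing measure. -/
theorem exists_ibp_basis_eq_integral (hON : Orthonormal ℝ e)
    (hTot : (Submodule.span ℝ (Set.range e)).topologicalClosure = ⊤)
    (hρpos : ∀ z, 0 ≤ ρ z) (hρ : Integrable ρ μ) (hρn : Integrable (fun z => ‖z‖ * ρ z) μ)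
    (hBV : BddAbove (BVset c e α μ ρ)) :
    ∃ (m : Measure H) (n : H → ℕ → ℝ), IsFiniteMeasure m ∧ (∀ j, Measurable fun z => n z j) ∧
      (∀ z, n z ∈ sqBall) ∧ m.real Set.univ = sSup (BVset c e α μ ρ) ∧
      ∀ (g : H → ℝ) (Dg : H → H), IsCb1 g Dg → ∀ j,
        ibp μ ρ g Dg (e j) (α j • e j) = ∫ z, g z * c j * n z j ∂m := by
  obtain ⟨M, hMfin, hMV, hM⟩ := exists_representsDivergence hON hρpos hρ hρn hBV
  obtain ⟨M', hMfin', rfl⟩ := exists_map_coords_eq hON hTot hρpos hρ hρn hM hMV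
  refine ⟨M'.fst, fun z j => ∫ b, b.1 j ∂(M'.condKernel z), inferInstance, fun j => ?_,
    fun z => integral_coord_mem_sqBall _, ?_, fun g Dg hg j => ?_⟩
  · exact (StronglyMeasurable.integral_kernel
      ((continuous_apply j).comp continuous_subtype_val).stronglyMeasurable).measurable
  · rw [← hMV, measureReal_def, measureReal_def, Measure.fst_univ,
      (measurableEmbedding_coords hON hTot).map_apply, Set.preimage_univ]
  · have hint : Integrable (fun p : H × sqBall => g p.1 * c j * p.2.1 j) M' := by
      obtain ⟨-, -, ⟨C, hC⟩, -⟩ := id hg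
      refine Integrable.of_bound ((((hg.continuous.comp continuous_fst).mul
        continuous_const).mul ((continuous_apply j).comp
        (continuous_subtype_val.comp continuous_snd))).aestronglyMeasurable) (C * |c j|)
        (ae_of_all _ fun p => ?_)
      have hC0 : 0 ≤ C := (abs_nonneg _).trans (hC p.1)
      rw [Real.norm_eq_abs, abs_mul, abs_mul]
      calc _ ≤ C * |c j| * 1 := by
            gcongr
            exacts [hC p.1, abs_le_one_of_mem_sqBall p.2.2 j]
        _ = _ := mul_one _
    rw [ibp_basis_eq_integral_prod hON hTot hρpos hρ hρn hM hg j, ← Measure.integral_condKernel hint]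
    simp only [integral_const_mul]

end Disintegration

section Representation

variable {H : Type*} [NormedAddCommGroup H] [InnerProductSpace ℝ H]
  [MeasurableSpace H] [BorelSpace H] {e : ℕ → H} {α c : ℕ → ℝ} {μ : Measure H} {ρ : H → ℝ}
  {m : Measure H} [IsFiniteMeasure m] {n : H → ℕ → ℝ}

omit [MeasurableSpace H] [BorelSpace H] in
lemma memH1.summable_sq {x : H} (hx : memH1 c e x) : Summable fun j => (c j * ⟪x, e j⟫) ^ 2 := by
  simp only [mul_pow]
  exact hx

omit [NormedAddCommGroup H] [InnerProductSpace ℝ H] [BorelSpace H] in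
lemma measurable_tsum_mul (hn : ∀ j, Measurable fun z => n z j) (x : ℕ → ℝ) :
    Measurable fun z => ∑' j, x j * n z j :=
  Measurable.tsum fun j => (hn j).const_mul _

lemma integrable_mul_tsum {g : H → ℝ} {Dg : H → H} (hg : IsCb1 g Dg)
    (hn : ∀ j, Measurable fun z => n z j) (hnb : ∀ z, n z ∈ sqBall) {x : ℕ → ℝ}
    (hx : Summable fun j => x j ^ 2) : Integrable (fun z => g z * ∑' j, x j * n z j) m := by
  obtain ⟨-, -, ⟨C, hC⟩, -⟩ := id hg
  refine Integrable.of_bound (hg.continuous.measurable.mul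
    (measurable_tsum_mul hn x)).aestronglyMeasurable (C * ((∑' j, x j ^ 2 + 1) / 2))
    (ae_of_all _ fun z => ?_)
  rw [Real.norm_eq_abs, abs_mul]
  exact mul_le_mul (hC z) (abs_tsum_mul_le_of_mem_sqBall hx (hnb z)) (abs_nonneg _)
    ((abs_nonneg _).trans (hC z))

lemma ibp_eq_integral_mul_tsum [CompleteSpace H] (hON : Orthonormal ℝ e)
    (hTot : (Submodule.span ℝ (Set.range e)).topologicalClosure = ⊤)
    (hρpos : ∀ z, 0 ≤ ρ z) (hρ : Integrable ρ μ) (hρn : Integrable (fun z => ‖z‖ * ρ z) μ)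
    (hn : ∀ j, Measurable fun z => n z j) (hnb : ∀ z, n z ∈ sqBall)
    {g : H → ℝ} {Dg : H → H} (hg : IsCb1 g Dg)
    (h : ∀ j, ibp μ ρ g Dg (e j) (α j • e j) = ∫ z, g z * c j * n z j ∂m)
    {l : H} (hl : memDA e α l) (hl' : memH1 c e l) :
    ibp μ ρ g Dg l (Aop e α l) = ∫ z, g z * ∑' j, c j * ⟪l, e j⟫ * n z j ∂m := by
  obtain ⟨-, -, ⟨C, hC⟩, -⟩ := id hg
  refine tendsto_nhds_unique (tendsto_sum_mul_ibp_basis hON hTot hρpos hρ hρn hg hl) ?_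
  have hint : ∀ j, Integrable (fun z => g z * (c j * ⟪l, e j⟫ * n z j)) m := fun j => by
    refine Integrable.of_bound (hg.continuous.measurable.mul
      ((hn j).const_mul _)).aestronglyMeasurable (C * (|c j * ⟪l, e j⟫| * 1))
      (ae_of_all _ fun z => ?_)
    have hC0 : 0 ≤ C := (abs_nonneg _).trans (hC z)
    rw [Real.norm_eq_abs, abs_mul, abs_mul]
    gcongr
    exacts [hC z, abs_le_one_of_mem_sqBall (hnb z) j]
  have hsum : ∀ N, ∑ j ∈ Finset.range N, ⟪l, e j⟫ * ibp μ ρ g Dg (e j) (α j • e j) =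
      ∫ z, g z * ∑ j ∈ Finset.range N, c j * ⟪l, e j⟫ * n z j ∂m := fun N => by
    simp only [Finset.mul_sum]
    rw [integral_finsetSum _ fun j _ => hint j]
    refine Finset.sum_congr rfl fun j _ => ?_
    rw [h j, ← integral_const_mul]
    congr with z
    ring
  simp only [hsum]
  refine tendsto_integral_of_dominated_convergence
    (fun _ => C * ((∑' j, (c j * ⟪l, e j⟫) ^ 2 + 1) / 2)) (fun N => ?_) (integrable_const _)
    (fun N => ae_of_all _ fun z => ?_) (ae_of_all _ fun z => ?_)
  · exact (hg.continuous.measurable.mul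
      (Finset.measurable_fun_sum _ fun j _ => (hn j).const_mul _)).aestronglyMeasurable
  · rw [Real.norm_eq_abs, abs_mul]
    exact mul_le_mul (hC z) (abs_sum_mul_le_of_mem_sqBall hl'.summable_sq (hnb z) N) (abs_nonneg _)
      ((abs_nonneg _).trans (hC z))
  · exact (summable_mul_of_sq hl'.summable_sq
      (summable_sq_of_mem_sqBall (hnb z))).tendsto_sum_tsum_nat.const_mul _

variable {k : ℕ} {g : Fin k → H → ℝ} {Dg : Fin k → H → H} {l : Fin k → H}

omit [MeasurableSpace H] [BorelSpace H] in
lemma sum_mul_tsum_eq (hnb : ∀ z, n z ∈ sqBall) (hl : ∀ i, memH1 c e (l i)) (z : H) :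
    ∑ i, g i z * ∑' j, c j * ⟪l i, e j⟫ * n z j =
      ∑' j, c j * ⟪∑ i, g i z • l i, e j⟫ * n z j := by
  simp only [← tsum_mul_left]
  rw [← Summable.tsum_finsetSum fun i _ => (summable_mul_of_sq (hl i).summable_sq
    (summable_sq_of_mem_sqBall (hnb z))).mul_left _]
  congr with j
  simp only [sum_inner, real_inner_smul_left, Finset.mul_sum, Finset.sum_mul]
  exact Finset.sum_congr rfl fun i _ => by ring

lemma integrable_pairing (hn : ∀ j, Measurable fun z => n z j) (hnb : ∀ z, n z ∈ sqBall)
    (hg : ∀ i, IsCb1 (g i) (Dg i)) (hl : ∀ i, memH1 c e (l i)) :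
    Integrable (fun z => ∑' j, c j * ⟪∑ i, g i z • l i, e j⟫ * n z j) m := by
  simp only [← sum_mul_tsum_eq hnb hl]
  exact integrable_finsetSum _ fun i _ => integrable_mul_tsum (hg i) hn hnb (hl i).summable_sq

lemma integral_Dstar_mul_eq_integral_pairing [CompleteSpace H] (hON : Orthonormal ℝ e)
    (hTot : (Submodule.span ℝ (Set.range e)).topologicalClosure = ⊤)
    (hρpos : ∀ z, 0 ≤ ρ z) (hρ : Integrable ρ μ) (hρn : Integrable (fun z => ‖z‖ * ρ z) μ)
    (hn : ∀ j, Measurable fun z => n z j) (hnb : ∀ z, n z ∈ sqBall)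
    (h : ∀ (g : H → ℝ) (Dg : H → H), IsCb1 g Dg → ∀ j,
      ibp μ ρ g Dg (e j) (α j • e j) = ∫ z, g z * c j * n z j ∂m)
    (hg : ∀ i, IsCb1 (g i) (Dg i)) (hl : ∀ i, memDA e α (l i)) (hl' : ∀ i, memH1 c e (l i)) :
    ∫ z, Dstar e α g Dg l z * ρ z ∂μ =
      ∫ z, ∑' j, c j * ⟪∑ i, g i z • l i, e j⟫ * n z j ∂m := by
  rw [integral_Dstar_mul hρpos hρ hρn hg]
  simp only [← sum_mul_tsum_eq hnb hl']
  rw [integral_finsetSum _ fun i _ => integrable_mul_tsum (hg i) hn hnb (hl' i).summable_sq]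
  exact Finset.sum_congr rfl fun i _ =>
    ibp_eq_integral_mul_tsum hON hTot hρpos hρ hρn hn hnb (hg i) (h _ _ (hg i)) (hl i) (hl' i)

lemma ae_tsum_sq_eq_one (hn : ∀ j, Measurable fun z => n z j) (hnb : ∀ z, n z ∈ sqBall)
    (hm : m.real Set.univ = sSup (BVset c e α μ ρ))
    (h : ∀ (k : ℕ) (g : Fin k → H → ℝ) (Dg : Fin k → H → H) (l : Fin k → H),
      (∀ i, IsCb1 (g i) (Dg i)) → (∀ i, memDA e α (l i)) → (∀ i, memH1 c e (l i)) →
      ∫ z, Dstar e α g Dg l z * ρ z ∂μ =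
        ∫ z, ∑' j, c j * ⟪∑ i, g i z • l i, e j⟫ * n z j ∂m) :
    ∀ᵐ z ∂m, ∑' j, n z j ^ 2 = 1 := by
  have hle : ∀ z, ∑' j, n z j ^ 2 ≤ 1 := fun z => tsum_sq_le_one_of_mem_sqBall (hnb z)
  have hint : Integrable (fun z => ∑' j, n z j ^ 2) m := by
    refine Integrable.of_bound
      (Measurable.tsum fun j => (hn j).pow_const 2).aestronglyMeasurable 1 (ae_of_all _ fun z => ?_)
    rw [Real.norm_of_nonneg (tsum_nonneg fun _ => sq_nonneg _)]
    exact hle z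
  have hint' : Integrable (fun z => 1 - ∑' j, n z j ^ 2) m := (integrable_const 1).sub hint
  have hV : sSup (BVset c e α μ ρ) ≤ ∫ z, (1 + ∑' j, n z j ^ 2) / 2 ∂m := by
    refine csSup_le ⟨0, zero_mem_BVset⟩ ?_
    rintro r ⟨k, g, Dg, l, hg, hl, hl', hG, rfl⟩
    rw [h k g Dg l hg hl hl']
    refine integral_mono (integrable_pairing hn hnb hg hl')
      (((integrable_const 1).add hint).div_const 2) fun z => ?_
    refine (tsum_mul_le_half_add_sq (hG z).1.summable_sq
      (summable_sq_of_mem_sqBall (hnb z))).trans ?_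
    have := (hG z).2
    simp only [normH1sq, ← mul_pow] at this
    gcongr
  have h0 : ∫ z, (1 - ∑' j, n z j ^ 2) ∂m = 0 := by
    refine le_antisymm ?_ (integral_nonneg fun z => sub_nonneg.2 (hle z))
    rw [← hm, integral_div, integral_add (integrable_const _) hint, integral_const, smul_eq_mul,
      mul_one] at hV
    rw [integral_sub (integrable_const _) hint, integral_const, smul_eq_mul, mul_one]
    linarith
  filter_upwards [(integral_eq_zero_iff_of_nonneg (fun z => sub_nonneg.2 (hle z)) hint').1 h0]
    with z hz
  exact (sub_eq_zero.1 hz).symm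

end Representation

/-- Theorem 3.1(ii), existence. If `ρ ∈ BV(H,H₁)`, `ρ ≥ 0`, `ρ ∈ L¹(H,μ)`,
then there are a finite positive Borel measure `m` on `H` and a Borel map `σ : H → H₁*`
(encoded by its coordinates `n z j` in the orthonormal basis `(c_j e_j)_j` of `H₁*`, so that
`‖σ(z)‖_{H₁*}² = ∑_j n z j ^ 2` and `⟨G, σ(z)⟩_{H₁,H₁*} = ∑_j c_j ⟨G, e_j⟩ n z j`) with
`‖σ(z)‖_{H₁*} = 1` `m`-a.e., `m(H) = V(ρ)` and
`∫ D*G ρ dμ = ∫ ⟨G(z), σ(z)⟩ m(dz)` for all `G ∈ (C_b¹)_{D(A)∩H₁}`. -/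
theorem bv_representation_exists
    {H : Type*} [NormedAddCommGroup H] [InnerProductSpace ℝ H] [CompleteSpace H]
    [SecondCountableTopology H] [MeasurableSpace H] [BorelSpace H]
    (e : ℕ → H) (hON : Orthonormal ℝ e)
    (hTot : (Submodule.span ℝ (Set.range e)).topologicalClosure = ⊤)
    (α : ℕ → ℝ) (δ : ℝ) (hδ : 0 < δ) (hαδ : ∀ j, δ ≤ α j)
    (hαsum : Summable fun j => (α j)⁻¹)
    (c : ℕ → ℝ) (hc : ∀ j, 1 ≤ c j)
    (μ : Measure H) [IsProbabilityMeasure μ]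
    (hGauss : ∀ h : H, μ.map (fun x => ⟪x, h⟫)
      = ProbabilityTheory.gaussianReal 0 (Real.toNNReal ⟪Qop e α h, h⟫))
    (ρ : H → ℝ) (hρmeas : Measurable ρ) (hρpos : ∀ z, 0 ≤ ρ z)
    (hρint : Integrable ρ μ)
    (hρA12 : Integrable (fun z => A12 |ρ z|) μ)
    (hρBV : BddAbove (BVset c e α μ ρ)) :
    ∃ (m : Measure H) (n : H → ℕ → ℝ),
      IsFiniteMeasure m ∧ (∀ j, Measurable fun z => n z j) ∧
      (∀ᵐ z ∂m, (∑' j, n z j ^ 2) = 1) ∧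
      m Set.univ = ENNReal.ofReal (sSup (BVset c e α μ ρ)) ∧
      ∀ (k : ℕ) (g : Fin k → H → ℝ) (Dg : Fin k → H → H) (l : Fin k → H),
        (∀ i, IsCb1 (g i) (Dg i)) → (∀ i, memDA e α (l i)) → (∀ i, memH1 c e (l i)) →
        ∫ z, Dstar e α g Dg l z * ρ z ∂μ
          = ∫ z, (∑' j, c j * ⟪∑ i, g i z • l i, e j⟫ * n z j) ∂m := by
  have : ProbabilityTheory.IsGaussian μ := by
    refine ProbabilityTheory.isGaussian_of_map_eq_gaussianReal fun L =>
      ⟨0, Real.toNNReal ⟪Qop e α ((InnerProductSpace.toDual ℝ H).symm L),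
        (InnerProductSpace.toDual ℝ H).symm L⟫, ?_⟩
    rw [← hGauss]
    congr with x
    rw [real_inner_comm, InnerProductSpace.toDual_symm_apply]
  have hρn : Integrable (fun z => ‖z‖ * ρ z) μ :=
    integrable_norm_mul_of_integrable_A12 hρmeas hρpos hρA12
  obtain ⟨m, n, hmfin, hn, hnb, hmV, hibp⟩ :=
    exists_ibp_basis_eq_integral hON hTot hρpos hρint hρn hρBV
  have hrep : ∀ (k : ℕ) (g : Fin k → H → ℝ) (Dg : Fin k → H → H) (l : Fin k → H),
      (∀ i, IsCb1 (g i) (Dg i)) → (∀ i, memDA e α (l i)) → (∀ i, memH1 c e (l i)) →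
      ∫ z, Dstar e α g Dg l z * ρ z ∂μ =
        ∫ z, ∑' j, c j * ⟪∑ i, g i z • l i, e j⟫ * n z j ∂m := fun k g Dg l hg hl hl' =>
    integral_Dstar_mul_eq_integral_pairing hON hTot hρpos hρint hρn hn hnb hibp hg hl hl'
  exact ⟨m, n, hmfin, hn, ae_tsum_sq_eq_one hn hnb hmV hrep, by rw [← hmV, ofReal_measureReal],
    hrep⟩
end
end

section
/- Theorem 3.1(ii), uniqueness: Suppose ρ ∈ BV(H,H₁), ρ ≥ 0 and ρ ∈ L¹(H,μ). If (m, σ) and (m', σ') are two pairs, each consisting of a finite positive Borel measure on H and a Borel map H → H₁* of H₁*-norm 1 almost everywhere with respect to that measure, such that ∫_H D*G(z) ρ(z) μ(dz) = ∫_H ⟨G(z), σ(z)⟩ m(dz) and ∫_H D*G(z) ρ(z) μ(dz) = ∫_H ⟨G(z), σ'(z)⟩ m'(dz) for all G ∈ (C_b¹)_{D(A)∩H₁}, then m = m' and σ(z) = σ'(z) for m-a.e. z. -/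
open MeasureTheory Filter
open scoped RealInnerProductSpace ENNReal NNReal BigOperators

noncomputable section

variable {H : Type*} [NormedAddCommGroup H] [InnerProductSpace ℝ H]

variable [MeasurableSpace H]

theorem hasFDerivAt_inner_const {E : Type*} [NormedAddCommGroup E] [InnerProductSpace ℝ E]
    (t x : E) : HasFDerivAt (fun x : E => ⟪x, t⟫) (innerSL ℝ t) x := by
  have h : (fun x : E => ⟪x, t⟫) = innerSL ℝ t := funext fun y => real_inner_comm t y
  rw [h]
  exact (innerSL ℝ t).hasFDerivAt

theorem isCb1_cos_inner {E : Type*} [NormedAddCommGroup E] [InnerProductSpace ℝ E] (t : E) :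
    IsCb1 (fun x : E => Real.cos ⟪x, t⟫) (fun x => -Real.sin ⟪x, t⟫ • t) := by
  refine ⟨fun x => ?_, by fun_prop, ⟨1, fun x => Real.abs_cos_le_one _⟩, ‖t‖, fun x => ?_⟩
  · simpa only [map_smul] using (hasFDerivAt_inner_const t x).cos
  · rw [norm_smul, norm_neg, Real.norm_eq_abs]
    exact mul_le_of_le_one_left (norm_nonneg t) (Real.abs_sin_le_one _)

theorem isCb1_sin_inner {E : Type*} [NormedAddCommGroup E] [InnerProductSpace ℝ E] (t : E) :
    IsCb1 (fun x : E => Real.sin ⟪x, t⟫) (fun x => Real.cos ⟪x, t⟫ • t) := by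
  refine ⟨fun x => ?_, by fun_prop, ⟨1, fun x => Real.abs_sin_le_one _⟩, ‖t‖, fun x => ?_⟩
  · simpa using (hasFDerivAt_inner_const t x).sin
  · rw [norm_smul, Real.norm_eq_abs]
    exact mul_le_of_le_one_left (norm_nonneg t) (Real.abs_cos_le_one _)

/-- An integrable function whose integrals against all `C_b¹` functions vanish is zero a.e. -/
theorem ae_eq_zero_of_forall_isCb1_integral_eq_zero {E : Type*} [NormedAddCommGroup E]
    [InnerProductSpace ℝ E] [CompleteSpace E] [SecondCountableTopology E] [MeasurableSpace E]
    [BorelSpace E] {ν : Measure E} [IsFiniteMeasure ν] {h : E → ℝ} (hm : Measurable h)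
    (hi : Integrable h ν)
    (h0 : ∀ (g : E → ℝ) (Dg : E → E), IsCb1 g Dg → ∫ x, g x * h x ∂ν = 0) :
    h =ᵐ[ν] 0 := by
  have hm' : Measurable fun x => -h x := hm.neg
  have hfin : IsFiniteMeasure (ν.withDensity fun x => ENNReal.ofReal (h x)) :=
    isFiniteMeasure_withDensity_ofReal hi.2
  have hfin' : IsFiniteMeasure (ν.withDensity fun x => ENNReal.ofReal (-h x)) :=
    isFiniteMeasure_withDensity_ofReal hi.neg.2
  have hch : (ν.withDensity fun x => ENNReal.ofReal (h x))
      = ν.withDensity fun x => ENNReal.ofReal (-h x) := by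
    refine Measure.ext_of_charFun (funext fun t => ?_)
    have hexp : Measurable fun x : E => Complex.exp (⟪x, t⟫ * Complex.I) := by fun_prop
    have hbd : ∀ x : E, ‖Complex.exp (⟪x, t⟫ * Complex.I)‖ ≤ 1 := fun x =>
      (Complex.norm_exp_ofReal_mul_I _).le
    have hInt : ∀ f : E → ℝ, Integrable f ν →
        Integrable (fun x => f x • Complex.exp (⟪x, t⟫ * Complex.I)) ν := fun f hf =>
      hf.smul_bdd 1 hexp.aestronglyMeasurable (ae_of_all _ hbd)
    have hmax : ∀ x : ℝ, max x 0 - max (-x) 0 = x := fun x => by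
      rcases le_total x 0 with hx | hx <;> simp [hx]
    rw [charFun_apply, charFun_apply,
      integral_withDensity_eq_integral_toReal_smul hm.ennreal_ofReal
        (ae_of_all _ fun _ => ENNReal.ofReal_lt_top),
      integral_withDensity_eq_integral_toReal_smul hm'.ennreal_ofReal
        (ae_of_all _ fun _ => ENNReal.ofReal_lt_top), ← sub_eq_zero]
    simp only [ENNReal.toReal_ofReal']
    rw [← integral_sub (hInt _ hi.pos_part) (hInt _ hi.neg_part)]
    simp only [← sub_smul, hmax]
    apply Complex.ext
    · have := integral_re (𝕜 := ℂ) (hInt h hi)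
      simp only [Complex.real_smul, RCLike.re_eq_complex_re, Complex.re_ofReal_mul,
        Complex.exp_ofReal_mul_I_re] at this ⊢
      rw [← this, Complex.zero_re, ← h0 _ _ (isCb1_cos_inner t)]
      simp only [mul_comm]
    · have := integral_im (𝕜 := ℂ) (hInt h hi)
      simp only [Complex.real_smul, RCLike.im_eq_complex_im, Complex.im_ofReal_mul,
        Complex.exp_ofReal_mul_I_im] at this ⊢
      rw [← this, Complex.zero_im, ← h0 _ _ (isCb1_sin_inner t)]
      simp only [mul_comm]
  have hae := (withDensity_eq_iff hm.ennreal_ofReal.aemeasurable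
    hm'.ennreal_ofReal.aemeasurable hi.lintegral_lt_top.ne).1 hch
  filter_upwards [hae] with x hx
  rcases le_total (h x) 0 with hx0 | hx0
  · rw [ENNReal.ofReal_of_nonpos hx0] at hx
    have := ENNReal.ofReal_eq_zero.1 hx.symm
    simp only [Pi.zero_apply]
    linarith
  · rw [ENNReal.ofReal_of_nonpos (p := -h x) (by linarith)] at hx
    exact le_antisymm (ENNReal.ofReal_eq_zero.1 hx) hx0

theorem abs_le_one_of_tsum_sq_eq_one {a : ℕ → ℝ} (h : ∑' j, a j ^ 2 = 1) (j : ℕ) :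
    |a j| ≤ 1 := by
  have hs : Summable fun j => a j ^ 2 := by
    by_contra hs
    rw [tsum_eq_zero_of_not_summable hs] at h
    exact zero_ne_one h
  have := hs.le_tsum j fun i _ => sq_nonneg (a i)
  rw [h] at this
  exact (sq_le_one_iff_abs_le_one _).1 this

theorem tsum_weight_inner_orthonormal {E : Type*} [NormedAddCommGroup E] [InnerProductSpace ℝ E]
    {e : ℕ → E} (hON : Orthonormal ℝ e) (c a : ℕ → ℝ) (k : ℕ) (r : ℝ) :
    ∑' j, c j * ⟪r • e k, e j⟫ * a j = c k * (r * a k) := by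
  rw [tsum_eq_single k]
  · simp [real_inner_smul_left, hON.1 k]
    ring
  · intro j hj
    simp [real_inner_smul_left, hON.2 hj.symm]

theorem summable_weight_inner_sq {E : Type*} [NormedAddCommGroup E] [InnerProductSpace ℝ E]
    {e : ℕ → E} (hON : Orthonormal ℝ e) (c : ℕ → ℝ) (k : ℕ) :
    Summable fun j => c j ^ 2 * ⟪e k, e j⟫ ^ 2 :=
  summable_of_ne_finset_zero (s := {k}) fun j hj => by
    rw [Finset.mem_singleton] at hj
    simp [hON.2 (Ne.symm hj)]

/-- A measure together with a field of unit vectors is determined by the vector measure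
they define. -/
theorem unit_field_unique {E : Type*} [NormedAddCommGroup E]
    [InnerProductSpace ℝ E] [CompleteSpace E] [SecondCountableTopology E] [MeasurableSpace E]
    [BorelSpace E] {m m' : Measure E} [IsFiniteMeasure m] [IsFiniteMeasure m']
    {n n' : E → ℕ → ℝ}
    (hn : ∀ j, Measurable fun z => n z j) (hn' : ∀ j, Measurable fun z => n' z j)
    (hunit : ∀ᵐ z ∂m, ∑' j, n z j ^ 2 = 1) (hunit' : ∀ᵐ z ∂m', ∑' j, n' z j ^ 2 = 1)
    (heq : ∀ j (g : E → ℝ) (Dg : E → E), IsCb1 g Dg →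
      ∫ z, g z * n z j ∂m = ∫ z, g z * n' z j ∂m') :
    m = m' ∧ ∀ᵐ z ∂m, ∀ j, n z j = n' z j := by
  set ν := m + m' with hν
  have hac : m ≪ ν := Measure.absolutelyContinuous_of_le (Measure.le_add_right le_rfl)
  have hac' : m' ≪ ν := Measure.absolutelyContinuous_of_le (Measure.le_add_left le_rfl)
  have hInt : ∀ j, Integrable (fun z => n z j) m := fun j =>
    Integrable.of_bound (hn j).aestronglyMeasurable 1
      (hunit.mono fun z hz => abs_le_one_of_tsum_sq_eq_one hz j)
  have hInt' : ∀ j, Integrable (fun z => n' z j) m' := fun j =>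
    Integrable.of_bound (hn' j).aestronglyMeasurable 1
      (hunit'.mono fun z hz => abs_le_one_of_tsum_sq_eq_one hz j)
  have hprod : ∀ j, ∀ᵐ z ∂ν,
      (m.rnDeriv ν z).toReal * n z j = (m'.rnDeriv ν z).toReal * n' z j := by
    intro j
    have hi : Integrable (fun z => (m.rnDeriv ν z).toReal * n z j) ν :=
      (integrable_rnDeriv_smul_iff hac).2 (hInt j)
    have hi' : Integrable (fun z => (m'.rnDeriv ν z).toReal * n' z j) ν :=
      (integrable_rnDeriv_smul_iff hac').2 (hInt' j)
    have := ae_eq_zero_of_forall_isCb1_integral_eq_zero (ν := ν)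
      (h := fun z => (m.rnDeriv ν z).toReal * n z j - (m'.rnDeriv ν z).toReal * n' z j)
      (((Measure.measurable_rnDeriv _ _).ennreal_toReal.mul (hn j)).sub
        ((Measure.measurable_rnDeriv _ _).ennreal_toReal.mul (hn' j))) (hi.sub hi') ?_
    · exact this.mono fun z hz => sub_eq_zero.1 hz
    · intro g Dg hg
      have hgc : Continuous g := continuous_iff_continuousAt.2 fun x => (hg.1 x).continuousAt
      obtain ⟨C, hC⟩ := hg.2.2.1
      have hgi : ∀ f : E → ℝ, Integrable f ν → Integrable (fun z => g z * f z) ν := fun f hf =>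
        hf.bdd_mul hgc.aestronglyMeasurable (ae_of_all _ hC)
      simp only [mul_sub]
      rw [integral_sub (hgi _ hi) (hgi _ hi'), sub_eq_zero]
      simp only [mul_left_comm (g _)]
      have h1 := integral_rnDeriv_smul hac (f := fun z => g z * n z j)
      have h2 := integral_rnDeriv_smul hac' (f := fun z => g z * n' z j)
      simp only [smul_eq_mul] at h1 h2
      rw [h1, h2, heq j g Dg hg]
  have hu : ∀ᵐ z ∂ν, m.rnDeriv ν z ≠ 0 → ∑' j, n z j ^ 2 = 1 := by
    rw [← Measure.withDensity_rnDeriv_eq m ν hac] at hunit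
    exact (ae_withDensity_iff (Measure.measurable_rnDeriv _ _)).1 hunit
  have hu' : ∀ᵐ z ∂ν, m'.rnDeriv ν z ≠ 0 → ∑' j, n' z j ^ 2 = 1 := by
    rw [← Measure.withDensity_rnDeriv_eq m' ν hac'] at hunit'
    exact (ae_withDensity_iff (Measure.measurable_rnDeriv _ _)).1 hunit'
  have hsq : ∀ {μ : Measure E} {a : ℕ → ℝ} {z : E},
      (μ.rnDeriv ν z ≠ 0 → ∑' j, a j ^ 2 = 1) →
      ∑' j, ((μ.rnDeriv ν z).toReal * a j) ^ 2 = (μ.rnDeriv ν z).toReal ^ 2 := by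
    intro μ a z h
    by_cases hz : μ.rnDeriv ν z = 0
    · simp [hz]
    · simp only [mul_pow]
      rw [tsum_mul_left, h hz, mul_one]
  have hdens : m.rnDeriv ν =ᵐ[ν] m'.rnDeriv ν := by
    filter_upwards [ae_all_iff.2 hprod, hu, hu', Measure.rnDeriv_lt_top m ν,
      Measure.rnDeriv_lt_top m' ν] with z hz h1 h2 hf hf'
    refine (ENNReal.toReal_eq_toReal_iff' hf.ne hf'.ne).1 ?_
    refine (sq_eq_sq₀ ENNReal.toReal_nonneg ENNReal.toReal_nonneg).1 ?_
    rw [← hsq h1, ← hsq h2]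
    simp only [hz]
  refine ⟨?_, ?_⟩
  · rw [← Measure.withDensity_rnDeriv_eq m ν hac, ← Measure.withDensity_rnDeriv_eq m' ν hac']
    exact withDensity_congr_ae hdens
  · filter_upwards [hac.ae_le (ae_all_iff.2 hprod), hac.ae_le hdens, Measure.rnDeriv_pos hac,
      hac.ae_le (Measure.rnDeriv_lt_top m ν)] with z hz hd hpos hlt j
    have := hz j
    rw [← hd] at this
    exact mul_left_cancel₀ (ENNReal.toReal_pos hpos.ne' hlt.ne).ne' this

/-- Theorem 3.1(ii), uniqueness. If `ρ ∈ BV(H,H₁)`, `ρ ≥ 0`, `ρ ∈ L¹(H,μ)`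
and `(m,σ)`, `(m',σ')` are two pairs of a finite positive Borel measure and a Borel map
`H → H₁*` of `H₁*`-norm one a.e. (encoded by coordinates `n`, `n'` in the orthonormal basis
`(c_j e_j)_j` of `H₁*`) both representing `ρ`, i.e.
`∫ D*G ρ dμ = ∫ ⟨G(z), σ(z)⟩ m(dz)` for all `G ∈ (C_b¹)_{D(A)∩H₁}` (and likewise for
`(m',σ')`), then `m = m'` and `σ = σ'` `m`-a.e. -/
theorem bv_representation_unique
    {H : Type*} [NormedAddCommGroup H] [InnerProductSpace ℝ H] [CompleteSpace H]
    [SecondCountableTopology H] [MeasurableSpace H] [BorelSpace H]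
    (e : ℕ → H) (hON : Orthonormal ℝ e)
    (hTot : (Submodule.span ℝ (Set.range e)).topologicalClosure = ⊤)
    (α : ℕ → ℝ) (δ : ℝ) (hδ : 0 < δ) (hαδ : ∀ j, δ ≤ α j)
    (hαsum : Summable fun j => (α j)⁻¹)
    (c : ℕ → ℝ) (hc : ∀ j, 1 ≤ c j)
    (μ : Measure H) [IsProbabilityMeasure μ]
    (hGauss : ∀ h : H, μ.map (fun x => ⟪x, h⟫)
      = ProbabilityTheory.gaussianReal 0 (Real.toNNReal ⟪Qop e α h, h⟫))
    (ρ : H → ℝ) (hρmeas : Measurable ρ) (hρpos : ∀ z, 0 ≤ ρ z)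
    (hρint : Integrable ρ μ)
    (hρA12 : Integrable (fun z => A12 |ρ z|) μ)
    (hρBV : BddAbove (BVset c e α μ ρ))
    (m m' : Measure H) [IsFiniteMeasure m] [IsFiniteMeasure m']
    (n n' : H → ℕ → ℝ)
    (hn : ∀ j, Measurable fun z => n z j) (hn' : ∀ j, Measurable fun z => n' z j)
    (hunit : ∀ᵐ z ∂m, (∑' j, n z j ^ 2) = 1)
    (hunit' : ∀ᵐ z ∂m', (∑' j, n' z j ^ 2) = 1)
    (hrep : ∀ (k : ℕ) (g : Fin k → H → ℝ) (Dg : Fin k → H → H) (l : Fin k → H),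
      (∀ i, IsCb1 (g i) (Dg i)) → (∀ i, memDA e α (l i)) → (∀ i, memH1 c e (l i)) →
      ∫ z, Dstar e α g Dg l z * ρ z ∂μ
        = ∫ z, (∑' j, c j * ⟪∑ i, g i z • l i, e j⟫ * n z j) ∂m)
    (hrep' : ∀ (k : ℕ) (g : Fin k → H → ℝ) (Dg : Fin k → H → H) (l : Fin k → H),
      (∀ i, IsCb1 (g i) (Dg i)) → (∀ i, memDA e α (l i)) → (∀ i, memH1 c e (l i)) →
      ∫ z, Dstar e α g Dg l z * ρ z ∂μ
        = ∫ z, (∑' j, c j * ⟪∑ i, g i z • l i, e j⟫ * n' z j) ∂m') :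
    m = m' ∧ ∀ᵐ z ∂m, ∀ j, n z j = n' z j := by
  refine unit_field_unique hn hn' hunit hunit' fun j g Dg hg => ?_
  have h := (hrep 1 (fun _ => g) (fun _ => Dg) (fun _ => e j) (fun _ => hg)
    (fun _ => summable_weight_inner_sq hON α j)
    (fun _ => summable_weight_inner_sq hON c j)).symm.trans
    (hrep' 1 (fun _ => g) (fun _ => Dg) (fun _ => e j) (fun _ => hg)
      (fun _ => summable_weight_inner_sq hON α j) (fun _ => summable_weight_inner_sq hON c j))
  simp only [Finset.univ_unique, Finset.sum_const, Finset.card_singleton, one_smul,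
    tsum_weight_inner_orthonormal hON, integral_const_mul] at h
  exact mul_left_cancel₀ (zero_lt_one.trans_le (hc j)).ne' h
end
end

section
/- Theorem 3.1(iii): Let ρ : H → ℝ be Borel with ∫_H A_{1/2}(|ρ|) dμ < ∞. Suppose there exist a finite positive Borel measure m on H and a Borel map σ : H → H₁* with ‖σ(z)‖_{H₁*} = 1 for m-a.e. z such that ∫_H D*G(z) ρ(z) μ(dz) = ∫_H ⟨G(z), σ(z)⟩ m(dz) for all G ∈ (C_b¹)_{D(A)∩H₁}. Then ρ ∈ BV(H,H₁) and V(ρ) = m(H). -/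
open MeasureTheory Filter
open scoped RealInnerProductSpace ENNReal NNReal BigOperators

noncomputable section

variable {H : Type*} [NormedAddCommGroup H] [InnerProductSpace ℝ H]

variable [MeasurableSpace H]

/-- `F` is bounded, continuously differentiable and Lipschitz. -/
def IsBddLipC1 {X E : Type*} [NormedAddCommGroup X] [NormedSpace ℝ X] [NormedAddCommGroup E]
    [NormedSpace ℝ E] (F : X → E) : Prop :=
  ContDiff ℝ 1 F ∧ (∃ C, ∀ x, ‖F x‖ ≤ C) ∧ ∃ K, LipschitzWith K F

namespace IsBddLipC1

section Normed

variable {X E E' : Type*} [NormedAddCommGroup X] [NormedSpace ℝ X] [NormedAddCommGroup E]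
  [NormedSpace ℝ E] [NormedAddCommGroup E'] [NormedSpace ℝ E']

theorem comp [ProperSpace E] {Φ : E → E'} {F : X → E} (hΦ : ContDiff ℝ 1 Φ)
    (hF : IsBddLipC1 F) : IsBddLipC1 fun x => Φ (F x) := by
  obtain ⟨h1, ⟨C, hC⟩, K, hK⟩ := hF
  have hmem : ∀ x, F x ∈ Metric.closedBall (0 : E) C := fun x => by simpa using hC x
  refine ⟨hΦ.comp h1, ?_, ?_⟩
  · obtain ⟨D, hD⟩ := (isCompact_closedBall (0 : E) C).exists_bound_of_continuousOn
      hΦ.continuous.continuousOn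
    exact ⟨D, fun x => hD _ (hmem x)⟩
  · obtain ⟨L, hL⟩ := hΦ.contDiffOn.exists_lipschitzOnWith one_ne_zero
      (convex_closedBall (0 : E) C) (isCompact_closedBall (0 : E) C)
    exact ⟨L * K, lipschitzOnWith_univ.1
      (hL.comp (lipschitzOnWith_univ.2 hK) fun x _ => hmem x)⟩

theorem pi {ι : Type*} [Fintype ι] {v : ι → X → ℝ} (hv : ∀ i, IsBddLipC1 (v i)) :
    IsBddLipC1 fun x i => v i x := by
  choose h1 h2 K hK using hv
  choose C hC using h2
  refine ⟨contDiff_pi.2 h1, ⟨∑ i, |C i|, fun x => ?_⟩, ∑ i, K i, ?_⟩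
  · refine (pi_norm_le_iff_of_nonneg (by positivity)).2 fun i => ?_
    exact ((hC i x).trans (le_abs_self _)).trans
      (Finset.single_le_sum (f := fun i => |C i|) (fun _ _ => abs_nonneg _) (Finset.mem_univ i))
  · refine LipschitzWith.of_dist_le_mul fun x y => ?_
    refine (dist_pi_le_iff (by positivity)).2 fun i => ((hK i).dist_le_mul x y).trans ?_
    gcongr
    exact Finset.single_le_sum (f := K) (fun _ _ => zero_le) (Finset.mem_univ i)

theorem add {v w : X → ℝ} (hv : IsBddLipC1 v) (hw : IsBddLipC1 w) :
    IsBddLipC1 fun x => v x + w x :=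
  comp (Φ := fun y : Fin 2 → ℝ => y 0 + y 1) (F := fun x i => ![v, w] i x) (by fun_prop)
    (pi (v := ![v, w]) fun i => by fin_cases i <;> assumption)

theorem const_mul {v : X → ℝ} (a : ℝ) (hv : IsBddLipC1 v) : IsBddLipC1 fun x => a * v x :=
  comp (Φ := fun y : ℝ => a * y) (by fun_prop) hv

theorem zero : IsBddLipC1 fun _ : X => (0 : ℝ) :=
  ⟨contDiff_const, ⟨0, by simp⟩, 0, LipschitzWith.const 0⟩

theorem continuous {F : X → E} (hF : IsBddLipC1 F) : Continuous F := hF.1.continuous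

theorem memLp [MeasurableSpace X] [BorelSpace X] {v : X → ℝ} (hv : IsBddLipC1 v)
    (m : Measure X) [IsFiniteMeasure m] (p : ℝ≥0∞) : MemLp v p m :=
  MemLp.of_bound hv.continuous.measurable.aestronglyMeasurable hv.2.1.choose
    (ae_of_all _ hv.2.1.choose_spec)

end Normed

section Inner

variable {X : Type*} [NormedAddCommGroup X] [InnerProductSpace ℝ X]

theorem comp_inner {φ : ℝ → ℝ} (hφ : ContDiff ℝ 1 φ) (hb : ∀ s, |φ s| ≤ 1)
    (hL : LipschitzWith 1 φ) (t : X) : IsBddLipC1 fun x => φ ⟪x, t⟫ :=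
  ⟨hφ.comp (contDiff_id.inner ℝ contDiff_const), ⟨1, fun _ => hb _⟩, _,
    hL.comp (by simpa [real_inner_comm] using (innerSL ℝ t).lipschitz)⟩

theorem isCb1 [CompleteSpace X] {v : X → ℝ} (hv : IsBddLipC1 v) : IsCb1 v (gradient v) := by
  obtain ⟨h1, h2, K, hK⟩ := hv
  refine ⟨fun x => ?_, ?_, h2, K, fun x => ?_⟩
  · exact ((h1.differentiable one_ne_zero) x).hasGradientAt.hasFDerivAt
  · exact (InnerProductSpace.toDual ℝ X).symm.continuous.comp (h1.continuous_fderiv one_ne_zero)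
  · simpa [gradient] using norm_fderiv_le_of_lipschitz ℝ hK

end Inner

end IsBddLipC1

section Density

variable {X : Type*} [NormedAddCommGroup X] [InnerProductSpace ℝ X] [CompleteSpace X]
  [SecondCountableTopology X] [MeasurableSpace X] [BorelSpace X]

theorem ae_eq_zero_of_forall_integral_trig_eq_zero (m : Measure X) [IsFiniteMeasure m] {h : X → ℝ}
    (hm : Measurable h) (hi : Integrable h m)
    (hcos : ∀ t : X, ∫ x, Real.cos ⟪x, t⟫ * h x ∂m = 0)
    (hsin : ∀ t : X, ∫ x, Real.sin ⟪x, t⟫ * h x ∂m = 0) : h =ᵐ[m] 0 := by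
  have hfin : ∀ f : X → ℝ, Integrable f m → ∫⁻ x, ENNReal.ofReal (f x) ∂m ≠ ∞ := fun f hf =>
    ((lintegral_ofReal_le_lintegral_enorm f).trans_lt hf.2).ne
  have : IsFiniteMeasure (m.withDensity fun x => ENNReal.ofReal (h x)) :=
    isFiniteMeasure_withDensity (hfin h hi)
  have : IsFiniteMeasure (m.withDensity fun x => ENNReal.ofReal (-h x)) :=
    isFiniteMeasure_withDensity (hfin _ hi.neg)
  have key : m.withDensity (fun x => ENNReal.ofReal (h x))
      = m.withDensity (fun x => ENNReal.ofReal (-h x)) := by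
    refine Measure.ext_of_charFun (funext fun t => ?_)
    have hE : ∀ x : X, ‖Complex.exp (⟪x, t⟫ * Complex.I)‖ ≤ 1 := fun x => by
      rw [Complex.norm_exp_ofReal_mul_I]
    have hEc : Continuous fun x : X => Complex.exp (⟪x, t⟫ * Complex.I) := by fun_prop
    have hint : ∀ f : X → ℝ, Integrable f m →
        Integrable (fun x => (f x : ℂ) * Complex.exp (⟪x, t⟫ * Complex.I)) m := fun f hf =>
      hf.ofReal.mul_bdd (c := 1) hEc.measurable.aestronglyMeasurable (ae_of_all _ hE)
    have hint' : ∀ φ : ℝ → ℝ, Continuous φ → (∀ s, |φ s| ≤ 1) →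
        Integrable (fun x => φ ⟪x, t⟫ * h x) m := fun φ hφ hb =>
      hi.bdd_mul (c := 1)
        (Continuous.measurable (by fun_prop)).aestronglyMeasurable (ae_of_all _ fun x => hb _)
    have hzero : ∫ x, (h x : ℂ) * Complex.exp (⟪x, t⟫ * Complex.I) ∂m = 0 := by
      have : ∀ x : X, (h x : ℂ) * Complex.exp (⟪x, t⟫ * Complex.I)
          = ((Real.cos ⟪x, t⟫ * h x : ℝ) : ℂ) + ((Real.sin ⟪x, t⟫ * h x : ℝ) : ℂ) * Complex.I := by
        intro x
        rw [Complex.exp_mul_I]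
        push_cast
        ring
      simp_rw [this]
      rw [integral_add (hint' _ Real.continuous_cos Real.abs_cos_le_one).ofReal
          ((hint' _ Real.continuous_sin Real.abs_sin_le_one).ofReal.mul_const _),
        integral_mul_const, integral_complex_ofReal, integral_complex_ofReal, hcos, hsin]
      simp
    rw [charFun_apply, charFun_apply,
      integral_withDensity_eq_integral_toReal_smul (by fun_prop) (by simp),
      integral_withDensity_eq_integral_toReal_smul (by fun_prop) (by simp), ← sub_eq_zero,
      ← hzero]
    simp only [ENNReal.toReal_ofReal', Complex.real_smul]
    rw [← integral_sub (hint _ hi.pos_part) (hint _ hi.neg_part)]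
    refine integral_congr_ae (ae_of_all _ fun x => ?_)
    simp only
    rw [← sub_mul, ← Complex.ofReal_sub, max_zero_sub_max_neg_zero_eq_self]
  filter_upwards [(withDensity_eq_iff (by fun_prop) (by fun_prop) (hfin h hi)).1 key] with x hx
  rcases le_total 0 (h x) with h0 | h0
  · rw [ENNReal.ofReal_of_nonpos (neg_nonpos.2 h0), ENNReal.ofReal_eq_zero] at hx
    exact le_antisymm hx h0
  · rw [ENNReal.ofReal_of_nonpos h0, eq_comm, ENNReal.ofReal_eq_zero] at hx
    exact le_antisymm h0 (neg_nonpos.1 hx)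

/-- The classes in `L²(m)` of bounded Lipschitz `C¹` functions. -/
def bddLipC1Submodule (m : Measure X) [IsFiniteMeasure m] : Submodule ℝ (Lp ℝ 2 m) where
  carrier := {f | ∃ v : X → ℝ, IsBddLipC1 v ∧ f =ᵐ[m] v}
  add_mem' := by
    rintro f g ⟨v, hv, hfv⟩ ⟨w, hw, hgw⟩
    exact ⟨_, hv.add hw, (Lp.coeFn_add f g).trans (hfv.add hgw)⟩
  zero_mem' := ⟨_, IsBddLipC1.zero, Lp.coeFn_zero ℝ 2 m⟩
  smul_mem' := by
    rintro a f ⟨v, hv, hfv⟩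
    exact ⟨_, hv.const_mul a, (Lp.coeFn_smul a f).trans (hfv.const_smul a)⟩

theorem topologicalClosure_bddLipC1Submodule (m : Measure X) [IsFiniteMeasure m] :
    (bddLipC1Submodule m).topologicalClosure = ⊤ := by
  rw [Submodule.topologicalClosure_eq_top_iff, Submodule.eq_bot_iff]
  intro h hh
  have horth : ∀ v : X → ℝ, IsBddLipC1 v → ∫ x, v x * h x ∂m = 0 := by
    intro v hv
    have := (Submodule.mem_orthogonal _ h).1 hh ((hv.memLp m 2).toLp v)
      ⟨v, hv, (hv.memLp m 2).coeFn_toLp⟩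
    rw [L2.inner_def] at this
    rw [← this]
    refine integral_congr_ae ?_
    filter_upwards [(hv.memLp m 2).coeFn_toLp] with x hx
    rw [hx]
    simp [mul_comm]
  refine Lp.eq_zero_iff_ae_eq_zero.2 (ae_eq_zero_of_forall_integral_trig_eq_zero m
    (Lp.stronglyMeasurable h).measurable ((Lp.memLp h).integrable one_le_two) (fun t => ?_)
    fun t => ?_)
  · exact horth _ (.comp_inner Real.contDiff_cos Real.abs_cos_le_one Real.lipschitzWith_cos t)
  · exact horth _ (.comp_inner Real.contDiff_sin Real.abs_sin_le_one Real.lipschitzWith_sin t)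

theorem exists_isBddLipC1_integral_abs_sub_le (m : Measure X) [IsFiniteMeasure m] {f : X → ℝ}
    (hf : MemLp f 2 m) {η : ℝ} (hη : 0 < η) :
    ∃ v : X → ℝ, IsBddLipC1 v ∧ ∫ x, |f x - v x| ∂m ≤ η := by
  have hmem : hf.toLp f ∈ closure (bddLipC1Submodule m : Set (Lp ℝ 2 m)) := by
    rw [← Submodule.topologicalClosure_coe, topologicalClosure_bddLipC1Submodule]
    trivial
  set M : ℝ := m.real Set.univ ^ ((1 : ℝ) / 2)
  have hM : 0 ≤ M := by positivity
  obtain ⟨g, ⟨v, hv, hgv⟩, hg⟩ := Metric.mem_closure_iff.1 hmem (η / (M + 1)) (by positivity)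
  refine ⟨v, hv, ?_⟩
  have hsub : MemLp (fun x => f x - v x) 2 m := hf.sub (hv.memLp m 2)
  have h2 : (eLpNorm (fun x => f x - v x) 2 m).toReal ≤ η / (M + 1) := by
    rw [dist_eq_norm, Lp.norm_def] at hg
    refine le_of_eq_of_le ?_ hg.le
    congr 1
    refine eLpNorm_congr_ae ?_
    filter_upwards [Lp.coeFn_sub (hf.toLp f) g, hf.coeFn_toLp, hgv] with x h1 h2 h3
    rw [h1, Pi.sub_apply, h2, h3]
  have h1 := eLpNorm_le_eLpNorm_mul_rpow_measure_univ (μ := m) (p := 1) (q := 2) one_le_two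
    hsub.aestronglyMeasurable
  have h3 : ∫ x, |f x - v x| ∂m = (eLpNorm (fun x => f x - v x) 1 m).toReal := by
    rw [eLpNorm_one_eq_lintegral_enorm, ← integral_norm_eq_lintegral_enorm
      hsub.aestronglyMeasurable]
    rfl
  have hexp : (1 : ℝ) / ENNReal.toReal 1 - 1 / ENNReal.toReal 2 = 1 / 2 := by norm_num
  rw [hexp] at h1
  rw [h3]
  calc _ ≤ (eLpNorm (fun x => f x - v x) 2 m * m Set.univ ^ ((1 : ℝ) / 2)).toReal :=
        ENNReal.toReal_mono (ENNReal.mul_ne_top hsub.eLpNorm_ne_top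
          (ENNReal.rpow_ne_top_of_nonneg (by norm_num) (measure_ne_top _ _))) h1
    _ = (eLpNorm (fun x => f x - v x) 2 m).toReal * M := by
        rw [ENNReal.toReal_mul, ← ENNReal.toReal_rpow]; rfl
    _ ≤ η / (M + 1) * M := by gcongr
    _ ≤ η := by
        rw [div_mul_eq_mul_div, div_le_iff₀ (by positivity)]
        nlinarith

end Density

section SmoothNormalization

variable {ι : Type*} [Fintype ι]

/-- The `i`-th coordinate of `y / (ε² + |y|²)^{1/2}`, with `|y|` the Euclidean norm. -/
def smoothNormalize (ε : ℝ) (i : ι) (y : ι → ℝ) : ℝ :=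
  y i / Real.sqrt (ε ^ 2 + ∑ j, y j ^ 2)

theorem contDiff_smoothNormalize {ε : ℝ} (hε : 0 < ε) (i : ι) :
    ContDiff ℝ 1 (smoothNormalize (ι := ι) ε i) := by
  have hpos : ∀ y : ι → ℝ, 0 < ε ^ 2 + ∑ j, y j ^ 2 := fun y => by positivity
  refine ContDiff.div (by fun_prop) (ContDiff.sqrt (by fun_prop) fun y => (hpos y).ne') fun y => ?_
  exact (Real.sqrt_pos.2 (hpos y)).ne'

theorem sum_smoothNormalize_sq_le_one (ε : ℝ) (y : ι → ℝ) :
    ∑ i, smoothNormalize ε i y ^ 2 ≤ 1 := by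
  simp only [smoothNormalize, div_pow]
  rw [← Finset.sum_div, Real.sq_sqrt (by positivity)]
  exact div_le_one_of_le₀ (by nlinarith [sq_nonneg ε]) (by positivity)

theorem abs_le_one_of_sum_sq_le_one {p : ι → ℝ} (hp : ∑ i, p i ^ 2 ≤ 1) (i : ι) : |p i| ≤ 1 := by
  rw [← sq_le_one_iff_abs_le_one]
  exact (Finset.single_le_sum (f := fun i => p i ^ 2) (fun _ _ => sq_nonneg _)
    (Finset.mem_univ i)).trans hp

theorem sum_mul_le_sum_abs {a b : ι → ℝ} (ha : ∀ i, |a i| ≤ 1) :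
    ∑ i, a i * b i ≤ ∑ i, |b i| :=
  Finset.sum_le_sum fun i _ => (le_abs_self _).trans (by
    rw [abs_mul]
    exact mul_le_of_le_one_left (abs_nonneg _) (ha i))

theorem le_sum_smoothNormalize_mul {ε : ℝ} (hε : 0 < ε) (y : ι → ℝ) {p : ι → ℝ}
    (hp : ∑ i, p i ^ 2 ≤ 1) :
    ∑ i, p i ^ 2 - 2 * ∑ i, |p i - y i| - ε ≤ ∑ i, smoothNormalize ε i y * p i := by
  set Y := ∑ i, y i ^ 2 with hY
  set s := Real.sqrt (ε ^ 2 + Y) with hs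
  have hY0 : 0 ≤ Y := by positivity
  have hs2 : s ^ 2 = ε ^ 2 + Y := Real.sq_sqrt (by positivity)
  have hεs : ε ≤ s := Real.le_sqrt_of_sq_le (by linarith)
  have hs0 : 0 < s := hε.trans_le hεs
  have h1 : s - ε ≤ Y / s := by
    rw [le_div_iff₀ hs0]
    nlinarith
  have h2 : ∑ i, y i * p i ≤ s := by
    refine Real.le_sqrt_of_sq_le ?_
    refine (Finset.sum_mul_sq_le_sq_mul_sq _ _ _).trans ?_
    nlinarith [sq_nonneg ε, mul_le_mul_of_nonneg_left hp hY0]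
  have h3 : ∑ i, p i * (p i - y i) ≤ ∑ i, |p i - y i| :=
    sum_mul_le_sum_abs (abs_le_one_of_sum_sq_le_one hp)
  have h4 : ∑ i, smoothNormalize ε i y * (y i - p i) ≤ ∑ i, |p i - y i| := by
    simp_rw [abs_sub_comm (p _)]
    exact sum_mul_le_sum_abs (abs_le_one_of_sum_sq_le_one (sum_smoothNormalize_sq_le_one ε y))
  have h5 : ∑ i, smoothNormalize ε i y * y i = Y / s := by
    rw [hY, Finset.sum_div]
    exact Finset.sum_congr rfl fun i _ => by rw [smoothNormalize]; ring
  have h6 : ∑ i, p i * (p i - y i) = ∑ i, p i ^ 2 - ∑ i, y i * p i := by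
    rw [← Finset.sum_sub_distrib]
    exact Finset.sum_congr rfl fun i _ => by ring
  have h7 : ∑ i, smoothNormalize ε i y * (y i - p i)
      = Y / s - ∑ i, smoothNormalize ε i y * p i := by
    rw [← h5, ← Finset.sum_sub_distrib]
    exact Finset.sum_congr rfl fun i _ => by ring
  linarith

end SmoothNormalization

theorem abs_tsum_mul_le_one {a b : ℕ → ℝ} (ha : Summable fun j => a j ^ 2)
    (ha1 : ∑' j, a j ^ 2 ≤ 1) (hb : Summable fun j => b j ^ 2) (hb1 : ∑' j, b j ^ 2 ≤ 1) :
    |∑' j, a j * b j| ≤ 1 := by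
  have hle : ∀ j, ‖a j * b j‖ ≤ (a j ^ 2 + b j ^ 2) / 2 := fun j => by
    rw [Real.norm_eq_abs, abs_le]
    constructor <;> nlinarith [sq_nonneg (a j - b j), sq_nonneg (a j + b j)]
  refine (tsum_of_norm_bounded ((ha.hasSum.add hb.hasSum).div_const 2) hle).trans ?_
  linarith

section Orthonormal

variable {X : Type*} [NormedAddCommGroup X] [InnerProductSpace ℝ X] {e : ℕ → X}

theorem inner_sum_smul_inv_smul (hON : Orthonormal ℝ e) (c : ℕ → ℝ) {k : ℕ} (y : Fin k → ℝ)
    (j : ℕ) : ⟪∑ i, y i • (c i)⁻¹ • e i, e j⟫ = if h : j < k then y ⟨j, h⟩ * (c j)⁻¹ else 0 := by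
  rw [sum_inner]
  simp only [inner_smul_left, orthonormal_iff_ite.1 hON, RCLike.conj_to_real]
  split_ifs with h
  · rw [Finset.sum_eq_single ⟨j, h⟩]
    · simp
    · intro i _ hi
      have : (i : ℕ) ≠ j := fun hij => hi (Fin.ext hij)
      simp [this]
    · simp
  · refine Finset.sum_eq_zero fun i _ => ?_
    have : (i : ℕ) ≠ j := fun hij => h (hij ▸ i.2)
    simp [this]

theorem hasSum_mul_inner_sum_smul (hON : Orthonormal ℝ e) {c : ℕ → ℝ} (hc : ∀ j, 0 < c j) {k : ℕ}
    (y : Fin k → ℝ) (f : ℕ → ℝ → ℝ) (hf : ∀ j, f j 0 = 0) :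
    HasSum (fun j => f j (c j * ⟪∑ i, y i • (c i)⁻¹ • e i, e j⟫)) (∑ i : Fin k, f i (y i)) := by
  have hval : ∑ j ∈ Finset.range k, f j (c j * ⟪∑ i, y i • (c i)⁻¹ • e i, e j⟫)
      = ∑ i : Fin k, f i (y i) := by
    rw [Finset.sum_range]
    refine Finset.sum_congr rfl fun i _ => ?_
    rw [inner_sum_smul_inv_smul hON, dif_pos i.2]
    congr 1
    field_simp [(hc i).ne']
  rw [← hval]
  refine hasSum_sum_of_ne_finset_zero fun j hj => ?_
  rw [inner_sum_smul_inv_smul hON, dif_neg (by simpa using hj), mul_zero, hf]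

theorem summable_mul_inner_smul_sq (hON : Orthonormal ℝ e) (w : ℕ → ℝ) (a : ℝ) (i : ℕ) :
    Summable fun j => w j ^ 2 * ⟪a • e i, e j⟫ ^ 2 := by
  refine summable_of_ne_finset_zero (s := {i}) fun j hj => ?_
  have : i ≠ j := fun hij => hj (by simp [hij])
  simp [inner_smul_left, hON.2 this]

end Orthonormal

theorem exists_mem_BVset_ge {X : Type*} [NormedAddCommGroup X] [InnerProductSpace ℝ X]
    [CompleteSpace X] [SecondCountableTopology X] [MeasurableSpace X] [BorelSpace X]
    {e : ℕ → X} (hON : Orthonormal ℝ e) (α c : ℕ → ℝ) (hc : ∀ j, 0 < c j) (μ : Measure X)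
    (ρ : X → ℝ) (m : Measure X) [IsFiniteMeasure m] (n : X → ℕ → ℝ)
    (hn : ∀ j, Measurable fun z => n z j)
    (hrep : ∀ (k : ℕ) (g : Fin k → X → ℝ) (Dg : Fin k → X → X) (l : Fin k → X),
      (∀ i, IsCb1 (g i) (Dg i)) → (∀ i, memDA e α (l i)) → (∀ i, memH1 c e (l i)) →
      ∫ z, Dstar e α g Dg l z * ρ z ∂μ
        = ∫ z, (∑' j, c j * ⟪∑ i, g i z • l i, e j⟫ * n z j) ∂m)
    (k : ℕ) (hk : ∀ᵐ z ∂m, ∑ i : Fin k, n z i ^ 2 ≤ 1) {η : ℝ} (hη : 0 < η) :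
    ∃ r ∈ BVset c e α μ ρ, ∫ z, ∑ i : Fin k, n z i ^ 2 ∂m ≤ r + η := by
  set M : ℝ := m.real Set.univ
  have hM : 0 ≤ M := measureReal_nonneg
  set ε : ℝ := η / (M + 2 * k + 1) with hε_def
  have hε : 0 < ε := by positivity
  have hnLp : ∀ i : Fin k, MemLp (fun z => n z i) 2 m := fun i =>
    MemLp.of_bound (hn i).aestronglyMeasurable 1
      (hk.mono fun z hz => abs_le_one_of_sum_sq_le_one (p := fun i : Fin k => n z i) hz i)
  choose v hv hvle using fun i => exists_isBddLipC1_integral_abs_sub_le m (hnLp i) hε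
  set g : Fin k → X → ℝ := fun i z => smoothNormalize ε i fun i => v i z
  have hg : ∀ i, IsBddLipC1 (g i) := fun i =>
    (IsBddLipC1.pi hv).comp (contDiff_smoothNormalize hε i)
  have hg1 : ∀ z, ∑ i, g i z ^ 2 ≤ 1 := fun z => sum_smoothNormalize_sq_le_one ε _
  have hlA : ∀ i : Fin k, memDA e α ((c i)⁻¹ • e i) := fun i =>
    summable_mul_inner_smul_sq hON α _ _
  have hlH : ∀ i : Fin k, memH1 c e ((c i)⁻¹ • e i) := fun i =>
    summable_mul_inner_smul_sq hON c _ _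
  refine ⟨_, ⟨k, g, fun i => gradient (g i), fun i => (c i)⁻¹ • e i, fun i => (hg i).isCb1, hlA,
    hlH, fun z => ?_, rfl⟩, ?_⟩
  · have := hasSum_mul_inner_sum_smul hON hc (fun i => g i z) (fun _ t => t ^ 2) (by simp)
    simp only [mul_pow] at this
    exact ⟨this.summable, this.tsum_eq.trans_le (hg1 z)⟩
  · rw [hrep k g _ _ (fun i => (hg i).isCb1) hlA hlH]
    have hpair : ∀ z, ∑' j, c j * ⟪∑ i, g i z • (c i)⁻¹ • e i, e j⟫ * n z j
        = ∑ i : Fin k, g i z * n z i := fun z =>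
      (hasSum_mul_inner_sum_smul hON hc (fun i => g i z) (fun j t => t * n z j) (by simp)).tsum_eq
    simp_rw [hpair]
    have hi1 : Integrable (fun z => ∑ i : Fin k, n z i ^ 2) m :=
      integrable_finsetSum _ fun i _ => (hnLp i).integrable_sq
    have hi2 : ∀ i : Fin k, Integrable (fun z => |n z i - v i z|) m := fun i =>
      (((hnLp i).sub ((hv i).memLp m 2)).integrable one_le_two).abs
    have hi3 : Integrable (fun z => ∑ i : Fin k, g i z * n z i) m :=
      integrable_finsetSum _ fun i _ => ((hg i).memLp m 2).integrable_mul (hnLp i)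
    have hi2' : Integrable (fun z => 2 * ∑ i : Fin k, |n z i - v i z|) m :=
      (integrable_finsetSum _ fun i _ => hi2 i).const_mul 2
    have hi12 : Integrable (fun z => ∑ i : Fin k, n z i ^ 2 - 2 * ∑ i : Fin k, |n z i - v i z|) m :=
      hi1.sub hi2'
    have hle : ∫ z, (∑ i : Fin k, n z i ^ 2 - 2 * ∑ i : Fin k, |n z i - v i z| - ε) ∂m
        ≤ ∫ z, ∑ i : Fin k, g i z * n z i ∂m :=
      integral_mono_ae (hi12.sub (integrable_const ε)) hi3
        (hk.mono fun z hz => le_sum_smoothNormalize_mul hε (fun i => v i z) hz)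
    rw [integral_sub hi12 (integrable_const ε), integral_sub hi1 hi2',
      integral_const_mul, integral_finsetSum _ fun i _ => hi2 i, integral_const,
      smul_eq_mul] at hle
    have hsum : ∑ i : Fin k, ∫ z, |n z i - v i z| ∂m ≤ k * ε :=
      (Finset.sum_le_sum fun i _ => hvle i).trans (by simp)
    have hεη : (M + 2 * k + 1) * ε = η := by
      rw [hε_def]
      field_simp
    have hMε : m.real Set.univ * ε = M * ε := rfl
    linarith

/-- Theorem 3.1(iii). If `ρ ∈ L(log L)^{1/2}(H,μ)` admits a representation
`∫ D*G ρ dμ = ∫ ⟨G(z), σ(z)⟩ m(dz)` for all `G ∈ (C_b¹)_{D(A)∩H₁}`, with `m` a finite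
positive Borel measure and `σ : H → H₁*` Borel with `‖σ(z)‖_{H₁*} = 1` `m`-a.e. (encoded by
coordinates `n` in the orthonormal basis `(c_j e_j)_j` of `H₁*`), then `ρ ∈ BV(H,H₁)` and
`V(ρ) = m(H)`. -/
theorem bv_of_representation
    {H : Type*} [NormedAddCommGroup H] [InnerProductSpace ℝ H] [CompleteSpace H]
    [SecondCountableTopology H] [MeasurableSpace H] [BorelSpace H]
    (e : ℕ → H) (hON : Orthonormal ℝ e)
    (hTot : (Submodule.span ℝ (Set.range e)).topologicalClosure = ⊤)
    (α : ℕ → ℝ) (δ : ℝ) (hδ : 0 < δ) (hαδ : ∀ j, δ ≤ α j)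
    (hαsum : Summable fun j => (α j)⁻¹)
    (c : ℕ → ℝ) (hc : ∀ j, 1 ≤ c j)
    (μ : Measure H) [IsProbabilityMeasure μ]
    (hGauss : ∀ h : H, μ.map (fun x => ⟪x, h⟫)
      = ProbabilityTheory.gaussianReal 0 (Real.toNNReal ⟪Qop e α h, h⟫))
    (ρ : H → ℝ) (hρmeas : Measurable ρ)
    (hρA12 : Integrable (fun z => A12 |ρ z|) μ)
    (m : Measure H) [IsFiniteMeasure m]
    (n : H → ℕ → ℝ) (hn : ∀ j, Measurable fun z => n z j)
    (hunit : ∀ᵐ z ∂m, (∑' j, n z j ^ 2) = 1)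
    (hrep : ∀ (k : ℕ) (g : Fin k → H → ℝ) (Dg : Fin k → H → H) (l : Fin k → H),
      (∀ i, IsCb1 (g i) (Dg i)) → (∀ i, memDA e α (l i)) → (∀ i, memH1 c e (l i)) →
      ∫ z, Dstar e α g Dg l z * ρ z ∂μ
        = ∫ z, (∑' j, c j * ⟪∑ i, g i z • l i, e j⟫ * n z j) ∂m) :
    BddAbove (BVset c e α μ ρ) ∧ sSup (BVset c e α μ ρ) = (m Set.univ).toReal := by
  have hsum : ∀ z, (∑' j, n z j ^ 2) = 1 → Summable fun j => n z j ^ 2 := fun z hz => by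
    by_contra hs
    rw [tsum_eq_zero_of_not_summable hs] at hz
    exact zero_ne_one hz
  have hpart : ∀ᵐ z ∂m, ∀ k, ∑ i : Fin k, n z i ^ 2 ≤ 1 := by
    filter_upwards [hunit] with z hz k
    rw [Fin.sum_univ_eq_sum_range (fun i => n z i ^ 2), ← hz]
    exact (hsum z hz).sum_le_tsum _ fun _ _ => sq_nonneg _
  have hupper : ∀ r ∈ BVset c e α μ ρ, r ≤ m.real Set.univ := by
    rintro r ⟨k, g, Dg, l, hg, hlA, hlH, hG, rfl⟩
    rw [hrep k g Dg l hg hlA hlH]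
    rw [← one_mul (m.real Set.univ)]
    refine (Real.le_norm_self _).trans (norm_integral_le_of_norm_le_const (μ := m) (C := 1) ?_)
    filter_upwards [hunit] with z hz
    obtain ⟨hG1, hG2⟩ := hG z
    simp only [memH1, normH1sq, ← mul_pow] at hG1 hG2
    exact abs_tsum_mul_le_one hG1 hG2 (hsum z hz) hz.le
  have hbdd : BddAbove (BVset c e α μ ρ) := ⟨_, hupper⟩
  have hlower : ∀ k : ℕ, ∫ z, ∑ i : Fin k, n z i ^ 2 ∂m ≤ sSup (BVset c e α μ ρ) := by
    intro k
    refine le_of_forall_pos_le_add fun η hη => ?_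
    obtain ⟨r, hr, hle⟩ := exists_mem_BVset_ge hON α c (fun j => (zero_lt_one.trans_le (hc j)))
      μ ρ m n hn hrep k (hpart.mono fun z hz => hz k) hη
    linarith [le_csSup hbdd hr]
  have hlim : Tendsto (fun k : ℕ => ∫ z, ∑ i : Fin k, n z i ^ 2 ∂m) atTop
      (nhds (∫ _, (1 : ℝ) ∂m)) := by
    refine tendsto_integral_of_dominated_convergence (fun _ => (1 : ℝ))
      (fun k => Measurable.aestronglyMeasurable (by fun_prop)) (integrable_const (1 : ℝ)) (fun k => ?_) ?_
    · filter_upwards [hpart] with z hz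
      rw [Real.norm_of_nonneg (by positivity)]
      exact hz k
    · filter_upwards [hunit] with z hz
      simp_rw [Fin.sum_univ_eq_sum_range (fun i => n z i ^ 2)]
      rw [← hz]
      exact (hsum z hz).hasSum.tendsto_sum_nat
  have hne : (BVset c e α μ ρ).Nonempty := by
    obtain ⟨r, hr, -⟩ := exists_mem_BVset_ge hON α c (fun j => (zero_lt_one.trans_le (hc j)))
      μ ρ m n hn hrep 0 (hpart.mono fun z hz => hz 0) one_pos
    exact ⟨r, hr⟩
  refine ⟨hbdd, le_antisymm (csSup_le hne hupper) ?_⟩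
  simpa [Measure.real] using le_of_tendsto' hlim hlower
end
end
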